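/- arXiv:2008.07825 — 2 statements merged into one kernel-verified Lean document; each statement's English description precedes it below -/
import Mathlib

section
/- Let U_n be Haar distributed on the orthogonal group O(n). Then for every fixed k ∈ ℕ, the random vector (Tr(U_n), Tr(U_n²)/√2, …, Tr(U_n^k)/√k) converges in distribution, as n → ∞, to (N_1 + η_1, N_2 + η_2/√2, …, N_k + η_k/√k), where N_1, …, N_k are independent standard real Gaussian random variables and η_j := 1 if j is even and η_j := 0 if j is odd. -/
open MeasureTheory ProbabilityTheory Matrix Filter Topology

noncomputable section

instance matMS (n m R : Type*) [MeasurableSpace R] : MeasurableSpace (Matrix n m R) :=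
  MeasurableSpace.pi

/-- `μ` is the Haar probability measure on the orthogonal group `O(n)`, viewed as a
measure on the space of real `n × n` matrices: it is a probability measure, gives zero
mass to the complement of `O(n)`, and is invariant under left translation by elements
of `O(n)`. -/
def IsHaarON (n : ℕ) (μ : Measure (Matrix (Fin n) (Fin n) ℝ)) : Prop :=
  IsProbabilityMeasure μ ∧
  μ ((Matrix.orthogonalGroup (Fin n) ℝ : Set (Matrix (Fin n) (Fin n) ℝ))ᶜ) = 0 ∧
  ∀ V : Matrix (Fin n) (Fin n) ℝ, V ∈ Matrix.orthogonalGroup (Fin n) ℝ →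
    Measure.map (fun U => V * U) μ = μ

/-- `η j = 1` if `j` is even, `0` if `j` is odd. -/
def eta (j : ℕ) : ℝ := if Even j then 1 else 0

variable {n : ℕ}

/-- The trace of the `j`-th power of a square matrix. -/
def powerTrace (j : ℕ) (U : Matrix (Fin n) (Fin n) ℝ) : ℝ := trace (U ^ j)

/-- The trace of `U ^ i * (U ^ j)ᵀ`. -/
def mixedTrace (i j : ℕ) (U : Matrix (Fin n) (Fin n) ℝ) : ℝ := trace (U ^ i * (U ^ j)ᵀ)

@[fun_prop]
lemma continuous_powerTrace (j : ℕ) :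
    Continuous (powerTrace j : Matrix (Fin n) (Fin n) ℝ → ℝ) := by
  unfold powerTrace
  fun_prop

@[fun_prop]
lemma continuous_mixedTrace (i j : ℕ) :
    Continuous (mixedTrace i j : Matrix (Fin n) (Fin n) ℝ → ℝ) := by
  unfold mixedTrace
  fun_prop

section Orthogonal

lemma abs_trace_le_of_mem_orthogonalGroup {U : Matrix (Fin n) (Fin n) ℝ}
    (hU : U ∈ Matrix.orthogonalGroup (Fin n) ℝ) : |trace U| ≤ n := by
  have h : ∀ i ∈ Finset.univ, |U i i| ≤ 1 := fun i _ => entry_norm_bound_of_unitary hU i i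
  simpa [trace] using (Finset.abs_sum_le_sum_abs _ _).trans (Finset.sum_le_sum h)

lemma abs_powerTrace_le {U : Matrix (Fin n) (Fin n) ℝ}
    (hU : U ∈ Matrix.orthogonalGroup (Fin n) ℝ) (j : ℕ) : |powerTrace j U| ≤ n :=
  abs_trace_le_of_mem_orthogonalGroup (pow_mem hU j)

lemma mixedTrace_comm (i j : ℕ) (U : Matrix (Fin n) (Fin n) ℝ) :
    mixedTrace i j U = mixedTrace j i U := by
  rw [mixedTrace, ← trace_transpose, transpose_mul, transpose_transpose, mixedTrace]

lemma mixedTrace_add_left {U : Matrix (Fin n) (Fin n) ℝ}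
    (hU : U ∈ Matrix.orthogonalGroup (Fin n) ℝ) (i d : ℕ) :
    mixedTrace (d + i) i U = powerTrace d U := by
  have h := (Matrix.mem_orthogonalGroup_iff _ _).1 (pow_mem hU i)
  rw [mixedTrace, pow_add, mul_assoc, h, mul_one, powerTrace]

lemma mixedTrace_self {U : Matrix (Fin n) (Fin n) ℝ}
    (hU : U ∈ Matrix.orthogonalGroup (Fin n) ℝ) (i : ℕ) : mixedTrace i i U = n := by
  simpa [powerTrace] using mixedTrace_add_left hU i 0

lemma exists_mixedTrace_eq_powerTrace {U : Matrix (Fin n) (Fin n) ℝ}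
    (hU : U ∈ Matrix.orthogonalGroup (Fin n) ℝ) {i j : ℕ} (hij : i ≠ j) :
    ∃ d, 1 ≤ d ∧ d ≤ max i j ∧ (0 < min i j → d < max i j) ∧
      mixedTrace i j U = powerTrace d U := by
  wlog h : j < i generalizing i j
  · obtain ⟨d, h1, h2, h3, h4⟩ := this hij.symm (by omega)
    exact ⟨d, h1, by omega, by omega, by rw [mixedTrace_comm, h4]⟩
  refine ⟨i - j, by omega, by omega, by omega, ?_⟩
  conv_lhs => rw [← Nat.sub_add_cancel h.le]
  exact mixedTrace_add_left hU j (i - j)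

lemma isCompact_orthogonalGroup :
    IsCompact (Matrix.orthogonalGroup (Fin n) ℝ : Set (Matrix (Fin n) (Fin n) ℝ)) := by
  have hbox : IsCompact (Set.univ.pi fun _ : Fin n => Set.univ.pi fun _ : Fin n =>
      Set.Icc (-1 : ℝ) 1) :=
    isCompact_univ_pi fun _ => isCompact_univ_pi fun _ => isCompact_Icc
  refine IsCompact.of_isClosed_subset hbox (isClosed_unitary (R := Matrix (Fin n) (Fin n) ℝ)) ?_
  intro U hU a _ b _
  exact abs_le.1 (entry_norm_bound_of_unitary hU a b)

lemma exp_mem_orthogonalGroup {X : Matrix (Fin n) (Fin n) ℝ} (hX : Xᵀ = -X) :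
    NormedSpace.exp X ∈ Matrix.orthogonalGroup (Fin n) ℝ := by
  rw [Matrix.mem_orthogonalGroup_iff, ← Matrix.exp_transpose, hX,
    ← Matrix.exp_add_of_commute _ _ (Commute.neg_right (Commute.refl X))]
  simp

end Orthogonal

section Haar

variable {μ : Measure (Matrix (Fin n) (Fin n) ℝ)}
variable {E : Type*} [NormedAddCommGroup E]

instance borelSpace_matrix : BorelSpace (Matrix (Fin n) (Fin n) ℝ) :=
  inferInstanceAs (BorelSpace (Fin n → Fin n → ℝ))

instance secondCountableTopology_matrix :
    SecondCountableTopology (Matrix (Fin n) (Fin n) ℝ) :=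
  inferInstanceAs (SecondCountableTopology (Fin n → Fin n → ℝ))

lemma IsHaarON.ae_mem (hμ : IsHaarON n μ) :
    ∀ᵐ U ∂μ, U ∈ Matrix.orthogonalGroup (Fin n) ℝ :=
  hμ.2.1

lemma IsHaarON.integrable (hμ : IsHaarON n μ) {f : Matrix (Fin n) (Fin n) ℝ → E}
    (hf : Continuous f) : Integrable f μ := by
  have := hμ.1
  obtain ⟨C, hC⟩ := isCompact_orthogonalGroup.exists_bound_of_continuousOn (hf.continuousOn)
  exact Integrable.of_bound hf.aestronglyMeasurable C
    (hμ.ae_mem.mono fun U hU => hC U hU)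

variable [NormedSpace ℝ E]

/-- `f'` is on `O(n)` the derivative of `f` in the direction of the right-invariant
vector field `U ↦ X * U`. -/
def HasDerivAlong (X : Matrix (Fin n) (Fin n) ℝ) (f f' : Matrix (Fin n) (Fin n) ℝ → E) : Prop :=
  ∀ U ∈ Matrix.orthogonalGroup (Fin n) ℝ,
    HasDerivAt (fun t : ℝ => f (NormedSpace.exp (t • X) * U)) (f' U) 0

lemma HasDerivAlong.hasDerivAt {X : Matrix (Fin n) (Fin n) ℝ} (hX : Xᵀ = -X)
    {f f' : Matrix (Fin n) (Fin n) ℝ → E} (h : HasDerivAlong X f f')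
    {U : Matrix (Fin n) (Fin n) ℝ} (hU : U ∈ Matrix.orthogonalGroup (Fin n) ℝ) (t : ℝ) :
    HasDerivAt (fun s : ℝ => f (NormedSpace.exp (s • X) * U))
      (f' (NormedSpace.exp (t • X) * U)) t := by
  have hV : NormedSpace.exp (t • X) ∈ Matrix.orthogonalGroup (Fin n) ℝ :=
    exp_mem_orthogonalGroup (by rw [transpose_smul, hX, smul_neg])
  have h1 := h _ (mul_mem hV hU)
  rw [← sub_self t] at h1
  have h2 := h1.comp_sub_const t t
  refine h2.congr_of_eventuallyEq (Eventually.of_forall fun s => ?_)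
  have h3 : NormedSpace.exp (s • X) = NormedSpace.exp ((s - t) • X) * NormedSpace.exp (t • X) := by
    rw [← Matrix.exp_add_of_commute _ _
      (((Commute.refl X).smul_left _).smul_right _), ← add_smul, sub_add_cancel]
  simp only [h3, mul_assoc]

/-- Integration by parts: derivatives along right-invariant vector fields integrate to zero. -/
lemma IsHaarON.integral_eq_zero_of_hasDerivAlong (hμ : IsHaarON n μ)
    {X : Matrix (Fin n) (Fin n) ℝ} (hX : Xᵀ = -X)
    {f f' : Matrix (Fin n) (Fin n) ℝ → E} (h : HasDerivAlong X f f')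
    (hf : Continuous f) (hf' : Continuous f') : ∫ U, f' U ∂μ = 0 := by
  have := hμ.1
  have hV (t : ℝ) : NormedSpace.exp (t • X) ∈ Matrix.orthogonalGroup (Fin n) ℝ :=
    exp_mem_orthogonalGroup (by rw [transpose_smul, hX, smul_neg])
  obtain ⟨C, hC⟩ := isCompact_orthogonalGroup.exists_bound_of_continuousOn (hf'.continuousOn)
  have hcont (t : ℝ) : Continuous fun U => NormedSpace.exp (t • X) * U := by fun_prop
  have hderiv := (hasDerivAt_integral_of_dominated_loc_of_deriv_le (μ := μ) (x₀ := (0 : ℝ))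
    (s := Set.univ) (F := fun t U => f (NormedSpace.exp (t • X) * U))
    (F' := fun t U => f' (NormedSpace.exp (t • X) * U)) (bound := fun _ => C)
    univ_mem
    (Eventually.of_forall fun t => (hf.comp (hcont t)).aestronglyMeasurable)
    (hμ.integrable (hf.comp (hcont 0)))
    (hf'.comp (hcont 0)).aestronglyMeasurable
    (hμ.ae_mem.mono fun U hU t _ => hC _ (mul_mem (hV t) hU))
    (integrable_const C)
    (hμ.ae_mem.mono fun U hU t _ => h.hasDerivAt hX hU t)).2
  have hconst : (fun t : ℝ => ∫ U, f (NormedSpace.exp (t • X) * U) ∂μ) = fun _ => ∫ U, f U ∂μ := by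
    funext t
    conv_rhs => rw [← hμ.2.2 _ (hV t)]
    rw [integral_map (hcont t).aemeasurable hf.aestronglyMeasurable]
  rw [hconst] at hderiv
  simpa using hderiv.unique (hasDerivAt_const _ _)

end Haar

section Derivatives

variable {E : Type*} [NormedAddCommGroup E] [NormedSpace ℝ E]

attribute [local instance] Matrix.linftyOpNormedRing Matrix.linftyOpNormedAlgebra

lemma hasDerivAlong_pow_apply (X : Matrix (Fin n) (Fin n) ℝ) (j : ℕ) (a b : Fin n) :
    HasDerivAlong X (fun U => (U ^ j) a b)
      (fun U => ∑ i ∈ Finset.range j, (U ^ i * X * U ^ (j - i)) a b) := by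
  intro U _
  have h1 := (((hasDerivAt_exp_smul_const' (𝕂 := ℝ) X (0 : ℝ)).mul_const U).fun_pow' j)
  have h2 := (Matrix.entryLinearMap ℝ ℝ a b).toContinuousLinearMap.hasFDerivAt.comp_hasDerivAt _ h1
  refine h2.congr_deriv ?_
  change (∑ i ∈ Finset.range j, (NormedSpace.exp ((0 : ℝ) • X) * U) ^ (j.pred - i) *
    (X * NormedSpace.exp ((0 : ℝ) • X) * U) * (NormedSpace.exp ((0 : ℝ) • X) * U) ^ i) a b = _
  rw [← Finset.sum_range_reflect, Matrix.sum_apply]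
  refine Finset.sum_congr rfl fun i hi => ?_
  have hi := Finset.mem_range.1 hi
  have h3 : j - i = (j - 1 - i) + 1 := by omega
  have h4 : j - 1 - (j - 1 - i) = i := by omega
  simp [h3, h4, mul_assoc, pow_succ']

end Derivatives

lemma hasDerivAlong_powerTrace (X : Matrix (Fin n) (Fin n) ℝ) (j : ℕ) :
    HasDerivAlong X (powerTrace j) (fun U => j * trace (X * U ^ j)) := by
  intro U hU
  have h : HasDerivAt (fun t : ℝ => powerTrace j (NormedSpace.exp (t • X) * U))
      (∑ a, ∑ i ∈ Finset.range j, (U ^ i * X * U ^ (j - i)) a a) 0 :=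
    HasDerivAt.fun_sum (u := Finset.univ)
      (A := fun (a : Fin n) (t : ℝ) => ((NormedSpace.exp (t • X) * U) ^ j) a a)
      fun a _ => hasDerivAlong_pow_apply X j a a U hU
  refine h.congr_deriv ?_
  rw [Finset.sum_comm]
  have h2 : ∀ i ∈ Finset.range j,
      ∑ a, (U ^ i * X * U ^ (j - i)) a a = trace (X * U ^ j) := by
    intro i hi
    have hi := Finset.mem_range.1 hi
    change trace (U ^ i * X * U ^ (j - i)) = _
    rw [mul_assoc, trace_mul_comm, mul_assoc, ← pow_add, Nat.sub_add_cancel hi.le]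
  rw [Finset.sum_congr rfl h2]
  simp

section LoopEquation

lemma sum_mul_single_sub_single_mul (A B : Matrix (Fin n) (Fin n) ℝ) :
    ∑ a, ∑ b, (A * (single a b 1 - single b a 1 : Matrix (Fin n) (Fin n) ℝ) * B) b a =
      trace (A * Bᵀ) - trace A * trace B := by
  have h1 (a b : Fin n) : (A * (single a b 1 : Matrix (Fin n) (Fin n) ℝ) * B) b a = A b a * B b a := by
    simp [mul_apply, Matrix.mul_single_eq_updateCol_zero, Matrix.updateCol_apply]
  have h2 (a b : Fin n) : (A * (single b a 1 : Matrix (Fin n) (Fin n) ℝ) * B) b a = A b b * B a a := by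
    simp [mul_apply, Matrix.mul_single_eq_updateCol_zero, Matrix.updateCol_apply]
  simp only [mul_sub, sub_mul, Matrix.sub_apply, h1, h2, Finset.sum_sub_distrib]
  congr 1
  · rw [Finset.sum_comm]
    simp [trace, mul_apply]
  · rw [Finset.sum_comm]
    simp [trace, Finset.sum_mul_sum]

lemma sum_mul_trace_single_sub_single_mul (A B : Matrix (Fin n) (Fin n) ℝ) :
    ∑ a, ∑ b, A b a * trace ((single a b 1 - single b a 1) * B) =
      trace (A * Bᵀ) - trace (A * B) := by
  have h1 (a b : Fin n) : trace (single a b 1 * B) = B b a := by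
    simp [Matrix.trace_single_mul]
  simp only [sub_mul, trace_sub, h1, mul_sub, Finset.sum_sub_distrib]
  congr 1
  · rw [Finset.sum_comm]
    simp [trace, mul_apply]
  · rw [Finset.sum_comm]
    simp [trace, mul_apply]

variable {E : Type*} [NormedAddCommGroup E] [NormedSpace ℝ E]
variable {μ : Measure (Matrix (Fin n) (Fin n) ℝ)} {ι : Type*} [Fintype ι]

/-- The loop (Schwinger–Dyson) equation for a function `G` on `O(n)` whose gradient is
`∑ m, c m • ∇ Tr(U ^ e m)`. -/
lemma IsHaarON.integral_loop_eq_zero (hμ : IsHaarON n μ) (j : ℕ) (e : ι → ℕ)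
    {G : Matrix (Fin n) (Fin n) ℝ → E} {c : ι → Matrix (Fin n) (Fin n) ℝ → E}
    (hG : Continuous G) (hc : ∀ m, Continuous (c m))
    (hderiv : ∀ X : Matrix (Fin n) (Fin n) ℝ,
      HasDerivAlong X G fun U => ∑ m, (e m * trace (X * U ^ e m)) • c m U) :
    ∫ U, ((∑ i ∈ Finset.range j,
        (mixedTrace i (j - i) U - powerTrace i U * powerTrace (j - i) U)) • G U +
      ∑ m, (e m * (mixedTrace j (e m) U - powerTrace (j + e m) U)) • c m U) ∂μ = 0 := by
  let X (a b : Fin n) : Matrix (Fin n) (Fin n) ℝ := single a b 1 - single b a 1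
  have hX (a b : Fin n) : (X a b)ᵀ = -X a b := by simp [X]
  let F (a b : Fin n) (U : Matrix (Fin n) (Fin n) ℝ) : E :=
    (U ^ j) b a • ∑ m, (e m * trace (X a b * U ^ e m)) • c m U +
      (∑ i ∈ Finset.range j, (U ^ i * X a b * U ^ (j - i)) b a) • G U
  have hentry (i : ℕ) (a b : Fin n) :
      Continuous fun U : Matrix (Fin n) (Fin n) ℝ => (U ^ i) b a :=
    (continuous_pow i).matrix_elem b a
  have hFcont (a b : Fin n) : Continuous (F a b) := by
    have h1 (i : ℕ) : Continuous fun U : Matrix (Fin n) (Fin n) ℝ =>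
        (U ^ i * X a b * U ^ (j - i)) b a := Continuous.matrix_elem (by fun_prop) b a
    fun_prop
  have hF (a b : Fin n) : ∫ U, F a b U ∂μ = 0 := by
    refine hμ.integral_eq_zero_of_hasDerivAlong (hX a b) (f := fun U => (U ^ j) b a • G U)
      (fun U hU => ?_) (by fun_prop) (hFcont a b)
    have := (hasDerivAlong_pow_apply (X a b) j b a U hU).fun_smul (hderiv (X a b) U hU)
    simpa [F] using this
  have hsum : ∫ U, ∑ a, ∑ b, F a b U ∂μ = 0 := by
    rw [integral_finsetSum _ fun a _ => integrable_finsetSum _ fun b _ => hμ.integrable (hFcont a b)]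
    refine Finset.sum_eq_zero fun a _ => ?_
    rw [integral_finsetSum _ fun b _ => hμ.integrable (hFcont a b)]
    exact Finset.sum_eq_zero fun b _ => hF a b
  rw [← hsum]
  congr 1
  funext U
  simp only [F, Finset.sum_add_distrib, ← Finset.sum_smul]
  rw [add_comm]
  congr 1
  · have h1 (m : ι) : (e m * (mixedTrace j (e m) U - powerTrace (j + e m) U)) =
        ∑ a, ∑ b, (U ^ j) b a * (e m * trace (X a b * U ^ e m)) := by
      rw [mixedTrace, powerTrace, pow_add, ← sum_mul_trace_single_sub_single_mul]
      simp only [Finset.mul_sum]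
      refine Finset.sum_congr rfl fun a _ => Finset.sum_congr rfl fun b _ => ?_
      ring
    simp only [h1, Finset.sum_smul, Finset.smul_sum, smul_smul]
    rw [Finset.sum_comm]
    refine Finset.sum_congr rfl fun a _ => ?_
    rw [Finset.sum_comm]
  · congr 1
    simp only [mixedTrace, powerTrace, ← sum_mul_single_sub_single_mul]
    rw [Finset.sum_comm]
    refine Finset.sum_congr rfl fun a _ => ?_
    rw [Finset.sum_comm]

end LoopEquation

section Bounds

/-- The sum of the squares of the traces of the first `K` powers of a matrix. -/
def sqTraceSum (K : ℕ) (U : Matrix (Fin n) (Fin n) ℝ) : ℝ :=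
  ∑ d ∈ Finset.Icc 1 K, powerTrace d U ^ 2

@[fun_prop]
lemma continuous_sqTraceSum (K : ℕ) :
    Continuous (sqTraceSum K : Matrix (Fin n) (Fin n) ℝ → ℝ) := by
  unfold sqTraceSum
  fun_prop

lemma sqTraceSum_nonneg (K : ℕ) (U : Matrix (Fin n) (Fin n) ℝ) : 0 ≤ sqTraceSum K U :=
  Finset.sum_nonneg fun _ _ => sq_nonneg _

lemma sqTraceSum_mono {K L : ℕ} (h : K ≤ L) (U : Matrix (Fin n) (Fin n) ℝ) :
    sqTraceSum K U ≤ sqTraceSum L U :=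
  Finset.sum_le_sum_of_subset_of_nonneg (Finset.Icc_subset_Icc le_rfl h)
    fun _ _ _ => sq_nonneg _

lemma sq_powerTrace_le_sqTraceSum {d K : ℕ} (h1 : 1 ≤ d) (h2 : d ≤ K)
    (U : Matrix (Fin n) (Fin n) ℝ) : powerTrace d U ^ 2 ≤ sqTraceSum K U :=
  Finset.single_le_sum (f := fun d => powerTrace d U ^ 2) (fun _ _ => sq_nonneg _)
    (Finset.mem_Icc.2 ⟨h1, h2⟩)

lemma abs_powerTrace_le_one_add_sqTraceSum {d K : ℕ} (h1 : 1 ≤ d) (h2 : d ≤ K)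
    (U : Matrix (Fin n) (Fin n) ℝ) : |powerTrace d U| ≤ 1 + sqTraceSum K U := by
  have h := sq_powerTrace_le_sqTraceSum h1 h2 U
  rw [← sq_abs] at h
  nlinarith [sq_nonneg (|powerTrace d U| - 1), sq_nonneg (|powerTrace d U|)]

lemma abs_powerTrace_mul_le_sqTraceSum {d e K : ℕ} (hd1 : 1 ≤ d) (hd2 : d ≤ K)
    (he1 : 1 ≤ e) (he2 : e ≤ K) (U : Matrix (Fin n) (Fin n) ℝ) :
    |powerTrace d U * powerTrace e U| ≤ sqTraceSum K U := by
  have h := sq_powerTrace_le_sqTraceSum hd1 hd2 U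
  have h' := sq_powerTrace_le_sqTraceSum he1 he2 U
  rw [abs_le]
  constructor <;> nlinarith [sq_nonneg (powerTrace d U - powerTrace e U),
    sq_nonneg (powerTrace d U + powerTrace e U)]

lemma eta_nonneg (j : ℕ) : 0 ≤ eta j := by
  unfold eta
  split_ifs <;> norm_num

lemma eta_le_one (j : ℕ) : eta j ≤ 1 := by
  unfold eta
  split_ifs <;> norm_num

lemma sum_ite_two_mul_eq_eta {j : ℕ} (hj : 1 ≤ j) (x : ℝ) :
    ∑ i ∈ Finset.range (j - 1), (if 2 * (i + 1) = j then x else 0) = x * eta j := by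
  unfold eta
  split_ifs with h
  · obtain ⟨m, hm⟩ := h
    rw [Finset.sum_eq_single (m - 1)]
    · rw [if_pos (by omega), mul_one]
    · intro i _ hi
      exact if_neg (by omega)
    · intro hi
      exact absurd (Finset.mem_range.2 (by omega)) hi
  · rw [mul_zero]
    refine Finset.sum_eq_zero fun i _ => if_neg fun hi => h ⟨i + 1, by omega⟩

lemma abs_sum_mixedTrace_sub_add_sub_le {U : Matrix (Fin n) (Fin n) ℝ}
    (hU : U ∈ Matrix.orthogonalGroup (Fin n) ℝ) {j : ℕ} (hj : 1 ≤ j) :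
    |∑ i ∈ Finset.range j, (mixedTrace i (j - i) U - powerTrace i U * powerTrace (j - i) U)
      + n * powerTrace j U - n * eta j| ≤ |powerTrace j U| + j * (1 + 2 * sqTraceSum (j - 1) U) := by
  have hT := sqTraceSum_nonneg (j - 1) U
  obtain ⟨l, rfl⟩ : ∃ l, j = l + 1 := ⟨j - 1, by omega⟩
  have h0 : mixedTrace 0 (l + 1) U = powerTrace (l + 1) U := by
    rw [mixedTrace_comm]
    exact mixedTrace_add_left hU 0 (l + 1)
  have h0' : powerTrace 0 U = n := by simp [powerTrace]
  have heq : ∑ i ∈ Finset.range (l + 1),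
        (mixedTrace i (l + 1 - i) U - powerTrace i U * powerTrace (l + 1 - i) U)
      + n * powerTrace (l + 1) U - n * eta (l + 1) = powerTrace (l + 1) U +
      ∑ i ∈ Finset.range l, (mixedTrace (i + 1) (l + 1 - (i + 1)) U
        - powerTrace (i + 1) U * powerTrace (l + 1 - (i + 1)) U
        - if 2 * (i + 1) = l + 1 then (n : ℝ) else 0) := by
    have h1 := sum_ite_two_mul_eq_eta hj (n : ℝ)
    rw [Nat.add_sub_cancel] at h1
    rw [Finset.sum_range_succ', Nat.sub_zero, h0, h0']
    simp only [Finset.sum_sub_distrib, h1]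
    ring
  rw [heq]
  refine (abs_add_le _ _).trans (add_le_add le_rfl ?_)
  refine (Finset.abs_sum_le_sum_abs _ _).trans ?_
  have hterm : ∀ i ∈ Finset.range l, |mixedTrace (i + 1) (l + 1 - (i + 1)) U
        - powerTrace (i + 1) U * powerTrace (l + 1 - (i + 1)) U
        - if 2 * (i + 1) = l + 1 then (n : ℝ) else 0| ≤ 1 + 2 * sqTraceSum (l + 1 - 1) U := by
    intro i hi
    have hi := Finset.mem_range.1 hi
    have h1 := abs_powerTrace_mul_le_sqTraceSum (d := i + 1) (e := l + 1 - (i + 1))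
      (K := l + 1 - 1) (by omega) (by omega) (by omega) (by omega) U
    rw [abs_le] at h1
    split_ifs with h
    · have h2 : l + 1 - (i + 1) = i + 1 := by omega
      rw [h2] at h1 ⊢
      rw [mixedTrace_self hU, abs_le]
      constructor <;> linarith
    · obtain ⟨d, hd1, -, hd2, hd⟩ := exists_mixedTrace_eq_powerTrace hU
        (i := i + 1) (j := l + 1 - (i + 1)) (by omega)
      have h3 := abs_powerTrace_le_one_add_sqTraceSum (d := d) (K := l + 1 - 1) hd1
        (by have := hd2 (by omega); omega) U
      rw [abs_le] at h3
      rw [hd, abs_le]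
      constructor <;> linarith
  refine (Finset.sum_le_sum hterm).trans ?_
  rw [Finset.sum_const, Finset.card_range, nsmul_eq_mul]
  refine mul_le_mul_of_nonneg_right ?_ (by linarith)
  push_cast
  linarith

variable {μ : Measure (Matrix (Fin n) (Fin n) ℝ)}

lemma IsHaarON.loop_sq_powerTrace (hμ : IsHaarON n μ) (j : ℕ) :
    ∫ U, ((∑ i ∈ Finset.range j,
        (mixedTrace i (j - i) U - powerTrace i U * powerTrace (j - i) U)) * powerTrace j U +
      j * (mixedTrace j j U - powerTrace (j + j) U)) ∂μ = 0 := by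
  have h := hμ.integral_loop_eq_zero (ι := Unit) j (fun _ => j) (G := powerTrace j)
    (c := fun _ _ => (1 : ℝ)) (by fun_prop) (fun _ => continuous_const)
    (fun X U hU => by simpa using hasDerivAlong_powerTrace X j U hU)
  simpa using h

lemma IsHaarON.integral_sq_powerTrace_le (hμ : IsHaarON n μ) {j : ℕ} (hj : 1 ≤ j) :
    ∫ U, powerTrace j U ^ 2 ∂μ ≤
      4 * (1 + 3 * j + 2 * j * ∫ U, sqTraceSum (j - 1) U ∂μ) := by
  have := hμ.1
  have hT : 0 ≤ ∫ U, sqTraceSum (j - 1) U ∂μ := integral_nonneg fun U => sqTraceSum_nonneg _ _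
  rcases Nat.lt_or_ge n 2 with hn | hn
  · have h1 : ∫ U, powerTrace j U ^ 2 ∂μ ≤ ∫ _, (1 : ℝ) ∂μ := by
      refine integral_mono_ae (hμ.integrable (by fun_prop)) (integrable_const _)
        (hμ.ae_mem.mono fun U hU => ?_)
      have h2 := abs_powerTrace_le hU j
      have h3 : (n : ℝ) ≤ 1 := by exact_mod_cast (by omega : n ≤ 1)
      simpa using (sq_le_one_iff_abs_le_one _).2 (h2.trans h3)
    have h2 : ∫ _, (1 : ℝ) ∂μ = 1 := by simp
    nlinarith [mul_nonneg (Nat.cast_nonneg (α := ℝ) j) hT, Nat.cast_nonneg (α := ℝ) j]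
  · have hn' : (2 : ℝ) ≤ n := by exact_mod_cast hn
    have hbound : ∫ U, ((∑ i ∈ Finset.range j,
          (mixedTrace i (j - i) U - powerTrace i U * powerTrace (j - i) U)) * powerTrace j U +
        j * (mixedTrace j j U - powerTrace (j + j) U)) ∂μ ≤
        ∫ U, ((n / 4 + 1 - n) * powerTrace j U ^ 2 + (n * (1 + 3 * j)
          + n * (2 * j) * sqTraceSum (j - 1) U)) ∂μ := by
      refine integral_mono_ae (hμ.integrable (by fun_prop)) (hμ.integrable (by fun_prop))
        (hμ.ae_mem.mono fun U hU => ?_)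
      have h1 := abs_sum_mixedTrace_sub_add_sub_le hU hj
      have h2 := abs_powerTrace_le hU (j + j)
      have h3 := abs_powerTrace_le hU j
      have h4 := sqTraceSum_nonneg (j - 1) U
      have h5 := mixedTrace_self hU j
      dsimp only
      rw [h5]
      generalize ∑ i ∈ Finset.range j,
          (mixedTrace i (j - i) U - powerTrace i U * powerTrace (j - i) U) = S at *
      generalize powerTrace j U = p at *
      generalize sqTraceSum (j - 1) U = T at *
      have h6 : (S + n * p - n * eta j) * p ≤ p ^ 2 + j * (1 + 2 * T) * n := by
        calc (S + n * p - n * eta j) * p ≤ |(S + n * p - n * eta j) * p| := le_abs_self _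
          _ = |S + n * p - n * eta j| * |p| := abs_mul _ _
          _ ≤ (|p| + j * (1 + 2 * T)) * |p| := by gcongr
          _ = |p| ^ 2 + j * (1 + 2 * T) * |p| := by ring
          _ ≤ p ^ 2 + j * (1 + 2 * T) * n := by rw [sq_abs]; gcongr
      have h7 : eta j * p ≤ p ^ 2 / 4 + 1 := by
        nlinarith [sq_nonneg (p / 2 - eta j), eta_nonneg j, eta_le_one j]
      have h8 : n * (eta j * p) ≤ n * (p ^ 2 / 4 + 1) := by gcongr
      have h9 : (j : ℝ) * (n - powerTrace (j + j) U) ≤ j * (n + n) := by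
        gcongr
        linarith [(abs_le.1 h2).1]
      linarith
    rw [hμ.loop_sq_powerTrace j, integral_add (hμ.integrable (by fun_prop))
      (hμ.integrable (by fun_prop)), integral_const_mul, integral_add (hμ.integrable (by fun_prop))
      (hμ.integrable (by fun_prop)), integral_const_mul (n * (2 * j) : ℝ)] at hbound
    have h10 : ∫ _, (n * (1 + 3 * j) : ℝ) ∂μ = n * (1 + 3 * j) := by simp
    rw [h10] at hbound
    have h11 : 0 ≤ ∫ U, powerTrace j U ^ 2 ∂μ := integral_nonneg fun U => sq_nonneg _
    generalize ∫ U, powerTrace j U ^ 2 ∂μ = A at *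
    generalize ∫ U, sqTraceSum (j - 1) U ∂μ = T at *
    have h12 : n * (A / 4) ≤ n * (1 + 3 * j + 2 * j * T) := by nlinarith
    have h13 := le_of_mul_le_mul_left h12 (by linarith)
    linarith

lemma exists_integral_sqTraceSum_le (K : ℕ) :
    ∃ C : ℝ, ∀ (n : ℕ) (μ : Measure (Matrix (Fin n) (Fin n) ℝ)), IsHaarON n μ →
      ∫ U, sqTraceSum K U ∂μ ≤ C := by
  induction K with
  | zero => exact ⟨0, fun n μ _ => by simp [sqTraceSum]⟩
  | succ K ih =>
    obtain ⟨C, hC⟩ := ih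
    refine ⟨C + 4 * (1 + 3 * (K + 1 : ℕ) + 2 * (K + 1 : ℕ) * C), fun n μ hμ => ?_⟩
    have h1 := hμ.integral_sq_powerTrace_le (j := K + 1) (by omega)
    have h2 := hC n μ hμ
    have h3 : ∫ U, sqTraceSum (K + 1) U ∂μ =
        ∫ U, sqTraceSum K U ∂μ + ∫ U, powerTrace (K + 1) U ^ 2 ∂μ := by
      rw [← integral_add (hμ.integrable (by fun_prop)) (hμ.integrable (by fun_prop))]
      congr 1
      funext U
      exact Finset.sum_Icc_succ_top (by omega) _
    rw [h3]
    refine add_le_add h2 (h1.trans ?_)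
    rw [Nat.add_sub_cancel]
    gcongr

end Bounds

section CharacteristicFunction

variable {k : ℕ} {μ : Measure (Matrix (Fin n) (Fin n) ℝ)}

/-- The linear combination `∑ m, t m * Tr(U ^ (m + 1))` of traces of powers. -/
def traceComb (t : Fin k → ℝ) (U : Matrix (Fin n) (Fin n) ℝ) : ℝ :=
  ∑ m : Fin k, t m * powerTrace ((m : ℕ) + 1) U

@[fun_prop]
lemma continuous_traceComb (t : Fin k → ℝ) :
    Continuous (traceComb t : Matrix (Fin n) (Fin n) ℝ → ℝ) := by
  unfold traceComb
  fun_prop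

lemma traceComb_smul (s : ℝ) (t : Fin k → ℝ) (U : Matrix (Fin n) (Fin n) ℝ) :
    traceComb (s • t) U = s * traceComb t U := by
  simp [traceComb, Finset.mul_sum, mul_assoc]

lemma hasDerivAlong_cexp_traceComb (X : Matrix (Fin n) (Fin n) ℝ) (t : Fin k → ℝ) :
    HasDerivAlong X (fun U => Complex.exp (traceComb t U * Complex.I)) fun U =>
      ∑ m : Fin k, (((m : ℕ) + 1 : ℕ) * trace (X * U ^ ((m : ℕ) + 1))) •
        (t m * Complex.I * Complex.exp (traceComb t U * Complex.I)) := by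
  intro U hU
  have h1 : HasDerivAt (fun s : ℝ => traceComb t (NormedSpace.exp (s • X) * U))
      (∑ m : Fin k, t m * (((m : ℕ) + 1 : ℕ) * trace (X * U ^ ((m : ℕ) + 1)))) 0 :=
    HasDerivAt.fun_sum (u := Finset.univ)
      (A := fun (m : Fin k) (s : ℝ) => t m * powerTrace ((m : ℕ) + 1) (NormedSpace.exp (s • X) * U))
      fun m _ => (hasDerivAlong_powerTrace X _ U hU).const_mul (t m)
  have h2 := (h1.ofReal_comp.mul_const Complex.I).cexp
  refine h2.congr_deriv ?_
  simp only [zero_smul, NormedSpace.exp_zero, one_mul, Complex.ofReal_sum, Finset.sum_mul,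
    Finset.mul_sum]
  refine Finset.sum_congr rfl fun m _ => ?_
  rw [Complex.real_smul]
  push_cast
  ring

/-- The constant in the error term of the approximate Stein equation. -/
def steinBound (t : Fin k → ℝ) : ℝ :=
  1 + 2 * k + ∑ m : Fin k, 2 * ((m : ℕ) + 1 : ℕ) * |t m|

lemma steinBound_nonneg (t : Fin k → ℝ) : 0 ≤ steinBound t := by
  unfold steinBound
  positivity

lemma steinBound_smul_le {s : ℝ} (hs : |s| ≤ 1) (t : Fin k → ℝ) :
    steinBound (s • t) ≤ steinBound t := by
  unfold steinBound
  refine add_le_add le_rfl (Finset.sum_le_sum fun m _ =>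
    mul_le_mul_of_nonneg_left ?_ (by positivity))
  rw [Pi.smul_apply, smul_eq_mul, abs_mul]
  exact mul_le_of_le_one_left (abs_nonneg _) hs

lemma norm_loop_add_stein_le {U : Matrix (Fin n) (Fin n) ℝ}
    (hU : U ∈ Matrix.orthogonalGroup (Fin n) ℝ) (t : Fin k → ℝ) (j : Fin k) {z : ℂ}
    (hz : ‖z‖ = 1) :
    ‖((∑ i ∈ Finset.range (j + 1), (mixedTrace i (j + 1 - i) U -
          powerTrace i U * powerTrace (j + 1 - i) U)) • z +
        ∑ m : Fin k, (((m : ℕ) + 1 : ℕ) * (mixedTrace (j + 1) (m + 1) U -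
          powerTrace (j + 1 + (m + 1)) U)) • (t m * Complex.I * z)) +
      n * ((powerTrace (j + 1) U - eta (j + 1) - (j + 1 : ℕ) * t j * Complex.I) * z)‖ ≤
      steinBound t * (1 + sqTraceSum (2 * k) U) := by
  have hj := j.2
  have hT := sqTraceSum_nonneg (2 * k) U
  have h1 := abs_sum_mixedTrace_sub_add_sub_le hU (j := j + 1) (by omega)
  generalize ∑ i ∈ Finset.range (j + 1), (mixedTrace i (j + 1 - i) U -
          powerTrace i U * powerTrace (j + 1 - i) U) = S at *
  have hsum : ∑ m : Fin k, (if m = j then ((n * (((m : ℕ) + 1 : ℕ) * t m) : ℝ) : ℂ) *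
      Complex.I * z else 0) = n * ((j + 1 : ℕ) * t j * Complex.I * z) := by
    rw [Finset.sum_ite_eq' Finset.univ j, if_pos (Finset.mem_univ j)]
    push_cast
    ring
  have heq : (S • z +
        ∑ m : Fin k, (((m : ℕ) + 1 : ℕ) * (mixedTrace (j + 1) (m + 1) U -
          powerTrace (j + 1 + (m + 1)) U)) • (t m * Complex.I * z)) +
      n * ((powerTrace (j + 1) U - eta (j + 1) - (j + 1 : ℕ) * t j * Complex.I) * z) =
      ((S + n * powerTrace (j + 1) U - n * eta (j + 1) : ℝ) : ℂ) * z +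
        ∑ m : Fin k, ((((m : ℕ) + 1 : ℕ) * t m * (mixedTrace (j + 1) (m + 1) U -
          powerTrace (j + 1 + (m + 1)) U - if m = j then (n : ℝ) else 0) : ℝ) : ℂ) *
          (Complex.I * z) := by
    have h2 : ∑ m : Fin k, ((((m : ℕ) + 1 : ℕ) * t m * (mixedTrace (j + 1) (m + 1) U -
          powerTrace (j + 1 + (m + 1)) U - if m = j then (n : ℝ) else 0) : ℝ) : ℂ) *
          (Complex.I * z) =
        ∑ m : Fin k, (((m : ℕ) + 1 : ℕ) * (mixedTrace (j + 1) (m + 1) U -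
          powerTrace (j + 1 + (m + 1)) U)) • (t m * Complex.I * z) -
        n * ((j + 1 : ℕ) * t j * Complex.I * z) := by
      rw [← hsum, ← Finset.sum_sub_distrib]
      refine Finset.sum_congr rfl fun m _ => ?_
      rw [Complex.real_smul]
      split_ifs <;> push_cast <;> ring
    rw [h2, Complex.real_smul]
    push_cast
    ring
  rw [heq]
  have hfirst : ‖((S + n * powerTrace (j + 1) U - n * eta (j + 1) : ℝ) : ℂ) * z‖ ≤
      (1 + 2 * k) * (1 + sqTraceSum (2 * k) U) := by
    rw [norm_mul, hz, mul_one, Complex.norm_real, Real.norm_eq_abs]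
    refine h1.trans ?_
    have h2 := abs_powerTrace_le_one_add_sqTraceSum (d := j + 1) (K := 2 * k)
      (by omega) (by omega) U
    have h3 := sqTraceSum_mono (K := j + 1 - 1) (L := 2 * k) (by omega) U
    have h4 : ((j + 1 : ℕ) : ℝ) ≤ k := by exact_mod_cast hj
    have h5 : ((j + 1 : ℕ) : ℝ) * (1 + 2 * sqTraceSum (j + 1 - 1) U) ≤
        k * (2 * (1 + sqTraceSum (2 * k) U)) :=
      mul_le_mul h4 (by linarith) (by linarith [sqTraceSum_nonneg (j + 1 - 1) U]) (by positivity)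
    linarith
  have hterm (m : Fin k) : ‖((((m : ℕ) + 1 : ℕ) * t m * (mixedTrace (j + 1) (m + 1) U -
          powerTrace (j + 1 + (m + 1)) U - if m = j then (n : ℝ) else 0) : ℝ) : ℂ) *
          (Complex.I * z)‖ ≤
      2 * ((m : ℕ) + 1 : ℕ) * |t m| * (1 + sqTraceSum (2 * k) U) := by
    have hm := m.2
    rw [norm_mul, norm_mul, Complex.norm_I, hz, mul_one, mul_one, Complex.norm_real,
      Real.norm_eq_abs, abs_mul, abs_mul, Nat.abs_cast]
    have h2 := abs_powerTrace_le_one_add_sqTraceSum (d := j + 1 + (m + 1)) (K := 2 * k)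
      (by omega) (by omega) U
    have h3 : |mixedTrace (j + 1) (m + 1) U - powerTrace (j + 1 + (m + 1)) U -
        if m = j then (n : ℝ) else 0| ≤ 2 * (1 + sqTraceSum (2 * k) U) := by
      rw [abs_le] at h2
      split_ifs with h
      · subst h
        rw [mixedTrace_self hU, abs_le]
        constructor <;> linarith
      · have hne : (m : ℕ) ≠ j := fun h' => h (Fin.ext h')
        obtain ⟨d, hd1, hd2, -, hd⟩ := exists_mixedTrace_eq_powerTrace hU
          (i := j + 1) (j := m + 1) (by omega)
        have h4 := abs_powerTrace_le_one_add_sqTraceSum (d := d) (K := 2 * k) hd1 (by omega) U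
        rw [abs_le] at h4
        rw [hd, abs_le]
        constructor <;> linarith
    calc ((m : ℕ) + 1 : ℕ) * |t m| * _ ≤
        ((m : ℕ) + 1 : ℕ) * |t m| * (2 * (1 + sqTraceSum (2 * k) U)) := by gcongr
      _ = _ := by ring
  refine (norm_add_le _ _).trans ?_
  refine (add_le_add hfirst ((norm_sum_le _ _).trans
    (Finset.sum_le_sum fun m _ => hterm m))).trans_eq ?_
  rw [← Finset.sum_mul, ← add_mul, steinBound]

/-- Approximate Stein equation for the traces of powers of a Haar orthogonal matrix. -/
lemma IsHaarON.norm_stein_le (hμ : IsHaarON n μ) (t : Fin k → ℝ) (j : Fin k) :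
    n * ‖∫ U, (powerTrace (j + 1) U - eta (j + 1) - (j + 1 : ℕ) * t j * Complex.I) *
      Complex.exp (traceComb t U * Complex.I) ∂μ‖ ≤
      steinBound t * (1 + ∫ U, sqTraceSum (2 * k) U ∂μ) := by
  have := hμ.1
  have hcont : Continuous fun U : Matrix (Fin n) (Fin n) ℝ =>
      Complex.exp (traceComb t U * Complex.I) := by fun_prop
  have hloop := hμ.integral_loop_eq_zero (j + 1) (fun m : Fin k => (m : ℕ) + 1)
    (c := fun m U => t m * Complex.I * Complex.exp (traceComb t U * Complex.I))
    hcont (fun m => by fun_prop) (fun X => hasDerivAlong_cexp_traceComb X t)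
  have hint : ∫ U, (1 + sqTraceSum (2 * k) U) ∂μ = 1 + ∫ U, sqTraceSum (2 * k) U ∂μ := by
    rw [integral_add (integrable_const _) (hμ.integrable (by fun_prop))]
    simp
  rw [← hint, ← integral_const_mul, ← RCLike.norm_natCast (K := ℂ) n, ← norm_mul,
    ← integral_const_mul, ← zero_add (∫ U, _ * _ ∂μ), ← hloop,
    ← integral_add (hμ.integrable (by fun_prop)) (hμ.integrable (by fun_prop))]
  refine norm_integral_le_of_norm_le (hμ.integrable (by fun_prop))
    (hμ.ae_mem.mono fun U hU => ?_)
  exact norm_loop_add_stein_le hU t j (Complex.norm_exp_ofReal_mul_I _)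

lemma norm_mul_exp_sub_one_le {φ φ' : ℝ → ℂ} {M V ε : ℝ}
    (hφ : ∀ s, HasDerivAt φ (φ' s) s) (hφ0 : φ 0 = 1) (hV : 0 ≤ V)
    (h : ∀ s ∈ Set.Icc (0 : ℝ) 1, ‖φ' s - (M * Complex.I - s * V) * φ s‖ ≤ ε) :
    ‖φ 1 * Complex.exp (-(M * Complex.I - V / 2)) - 1‖ ≤ ε * Real.exp (V / 2) := by
  have hψ (s : ℝ) : HasDerivAt (fun s : ℝ => Complex.exp (-(s * (M * Complex.I) - s ^ 2 * (V / 2))))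
      (Complex.exp (-(s * (M * Complex.I) - s ^ 2 * (V / 2))) * -(M * Complex.I - s * V)) s := by
    have hid : HasDerivAt (fun s : ℝ => (s : ℂ)) 1 s := Complex.ofRealCLM.hasDerivAt
    have h1 := ((hid.mul_const (M * Complex.I)).sub ((hid.pow 2).mul_const ((V : ℂ) / 2))).neg.cexp
    refine h1.congr_deriv ?_
    simp
    ring
  have hder (s : ℝ) := (hφ s).fun_mul (hψ s)
  have hmain := norm_image_sub_le_of_norm_deriv_le_segment_01' (C := ε * Real.exp (V / 2))
    (fun s _ => (hder s).hasDerivWithinAt) (fun s hs => ?_)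
  · simpa [hφ0] using hmain
  · have h2 : φ' s * Complex.exp (-(s * (M * Complex.I) - s ^ 2 * (V / 2))) +
        φ s * (Complex.exp (-(s * (M * Complex.I) - s ^ 2 * (V / 2))) * -(M * Complex.I - s * V)) =
        (φ' s - (M * Complex.I - s * V) * φ s) *
          Complex.exp (-(s * (M * Complex.I) - s ^ 2 * (V / 2))) := by ring
    have h3 : (-(s * (M * Complex.I) - s ^ 2 * (V / 2)) : ℂ).re = s ^ 2 * (V / 2) := by
      have : (-(s * (M * Complex.I) - s ^ 2 * (V / 2)) : ℂ) =
        ((s ^ 2 * (V / 2) : ℝ) : ℂ) + ((-(s * M) : ℝ) : ℂ) * Complex.I := by push_cast; ring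
      rw [this]
      simp only [Complex.add_re, Complex.ofReal_re, Complex.re_ofReal_mul, Complex.I_re, mul_zero,
        add_zero]
    rw [h2, norm_mul, Complex.norm_exp, h3]
    have hs' : s ^ 2 ≤ 1 := pow_le_one₀ hs.1 hs.2.le
    have hε := h s ⟨hs.1, hs.2.le⟩
    have : s ^ 2 * (V / 2) ≤ V / 2 := mul_le_of_le_one_left (by positivity) hs'
    gcongr
    exact (norm_nonneg _).trans hε

lemma IsHaarON.hasDerivAt_integral_cexp (hμ : IsHaarON n μ) (t : Fin k → ℝ) (s : ℝ) :
    HasDerivAt (fun s : ℝ => ∫ U, Complex.exp (traceComb (s • t) U * Complex.I) ∂μ)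
      (∫ U, traceComb t U * Complex.I * Complex.exp (traceComb (s • t) U * Complex.I) ∂μ) s := by
  refine (hasDerivAt_integral_of_dominated_loc_of_deriv_le (s := Set.univ)
    (bound := fun U => |traceComb t U|)
    (F' := fun s U => traceComb t U * Complex.I * Complex.exp (traceComb (s • t) U * Complex.I))
    univ_mem
    (Eventually.of_forall fun s => Continuous.aestronglyMeasurable (by fun_prop))
    (hμ.integrable (by fun_prop)) (Continuous.aestronglyMeasurable (by fun_prop))
    (Eventually.of_forall fun U s _ => ?_) (hμ.integrable (by fun_prop))
    (Eventually.of_forall fun U s _ => ?_)).2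
  · rw [norm_mul, Complex.norm_exp_ofReal_mul_I]
    simp
  · simp only [traceComb_smul]
    have hid : HasDerivAt (fun s : ℝ => (s : ℂ)) 1 s := Complex.ofRealCLM.hasDerivAt
    have h1 := (hid.mul_const (traceComb t U * Complex.I)).cexp
    simp only [Complex.ofReal_mul, mul_assoc]
    refine h1.congr_deriv ?_
    ring

lemma IsHaarON.norm_deriv_sub_le (hμ : IsHaarON n μ) (t : Fin k → ℝ) {s : ℝ} (hs : |s| ≤ 1) :
    n * ‖∫ U, traceComb t U * Complex.I * Complex.exp (traceComb (s • t) U * Complex.I) ∂μ -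
      ((∑ j : Fin k, t j * eta (j + 1) : ℝ) * Complex.I -
        s * (∑ j : Fin k, ((j : ℕ) + 1 : ℕ) * t j ^ 2 : ℝ)) *
        ∫ U, Complex.exp (traceComb (s • t) U * Complex.I) ∂μ‖ ≤
      (∑ j, |t j|) * (steinBound t * (1 + ∫ U, sqTraceSum (2 * k) U ∂μ)) := by
  have := hμ.1
  have hT : 0 ≤ ∫ U, sqTraceSum (2 * k) U ∂μ := integral_nonneg fun U => sqTraceSum_nonneg _ _
  have heq : ∫ U, traceComb t U * Complex.I * Complex.exp (traceComb (s • t) U * Complex.I) ∂μ -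
      ((∑ j : Fin k, t j * eta (j + 1) : ℝ) * Complex.I -
        s * (∑ j : Fin k, ((j : ℕ) + 1 : ℕ) * t j ^ 2 : ℝ)) *
        ∫ U, Complex.exp (traceComb (s • t) U * Complex.I) ∂μ =
      ∑ j : Fin k, (t j * Complex.I) * ∫ U, (powerTrace (j + 1) U - eta (j + 1) -
        (j + 1 : ℕ) * (s • t) j * Complex.I) *
        Complex.exp (traceComb (s • t) U * Complex.I) ∂μ := by
    simp only [← integral_const_mul]
    rw [← integral_sub (hμ.integrable (by fun_prop)) (hμ.integrable (by fun_prop)),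
      ← integral_finsetSum _ fun j _ => hμ.integrable (by fun_prop)]
    congr 1
    funext U
    simp only [← mul_assoc]
    rw [← sub_mul, ← Finset.sum_mul]
    congr 1
    simp only [traceComb, Complex.ofReal_sum, Finset.sum_mul, Finset.mul_sum]
    rw [← Finset.sum_sub_distrib, ← Finset.sum_sub_distrib]
    refine Finset.sum_congr rfl fun j _ => ?_
    simp only [Pi.smul_apply, smul_eq_mul]
    push_cast
    linear_combination (s * (j + 1) * t j ^ 2 : ℂ) * Complex.I_sq
  rw [heq, Finset.sum_mul]
  calc (n : ℝ) * ‖∑ j : Fin k, _‖ ≤ n * ∑ j : Fin k, _ := by gcongr; exact norm_sum_le _ _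
    _ ≤ _ := by
      rw [Finset.mul_sum]
      refine Finset.sum_le_sum fun j _ => ?_
      rw [norm_mul, norm_mul, Complex.norm_I, mul_one, Complex.norm_real, Real.norm_eq_abs,
        mul_left_comm]
      refine mul_le_mul_of_nonneg_left ((hμ.norm_stein_le (s • t) j).trans ?_) (abs_nonneg _)
      exact mul_le_mul_of_nonneg_right (steinBound_smul_le hs t) (by linarith)

lemma tendsto_integral_cexp_traceComb (μ : ∀ n, Measure (Matrix (Fin n) (Fin n) ℝ))
    (hμ : ∀ n, IsHaarON n (μ n)) (t : Fin k → ℝ) :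
    Tendsto (fun n => ∫ U, Complex.exp (traceComb t U * Complex.I) ∂(μ n)) atTop
      (𝓝 (Complex.exp ((∑ j : Fin k, t j * eta (j + 1) : ℝ) * Complex.I -
        (∑ j : Fin k, ((j : ℕ) + 1 : ℕ) * t j ^ 2 : ℝ) / 2))) := by
  obtain ⟨C, hC⟩ := exists_integral_sqTraceSum_le (2 * k)
  set M : ℝ := ∑ j : Fin k, t j * eta (j + 1) with hM
  set V : ℝ := ∑ j : Fin k, ((j : ℕ) + 1 : ℕ) * t j ^ 2 with hV
  have hV0 : 0 ≤ V := by positivity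
  set D : ℝ := (∑ j, |t j|) * (steinBound t * (1 + C)) with hD
  have hbound (n : ℕ) (hn : 0 < n) :
      ‖(∫ U, Complex.exp (traceComb t U * Complex.I) ∂(μ n)) *
        Complex.exp (-(M * Complex.I - V / 2)) - 1‖ ≤ D * Real.exp (V / 2) * (n : ℝ)⁻¹ := by
    have := (hμ n).1
    have hn' : (0 : ℝ) < n := by exact_mod_cast hn
    have h1 := norm_mul_exp_sub_one_le (ε := D / n) ((hμ n).hasDerivAt_integral_cexp t)
      (by simp [traceComb]) hV0 (M := M) (fun s hs => ?_)
    · simp only [one_smul] at h1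
      refine h1.trans_eq ?_
      ring
    · rw [le_div_iff₀' hn']
      refine ((hμ n).norm_deriv_sub_le t (abs_le.2 ⟨by linarith [hs.1], hs.2⟩)).trans ?_
      have := steinBound_nonneg t
      have := hC n (μ n) (hμ n)
      rw [hD]
      gcongr
  have hlim : Tendsto (fun n => (∫ U, Complex.exp (traceComb t U * Complex.I) ∂(μ n)) *
        Complex.exp (-(M * Complex.I - V / 2))) atTop (𝓝 1) := by
    rw [tendsto_iff_norm_sub_tendsto_zero]
    have h0 : Tendsto (fun n : ℕ => D * Real.exp (V / 2) * (n : ℝ)⁻¹) atTop (𝓝 0) := by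
      simpa using tendsto_inv_atTop_nhds_zero_nat.const_mul (D * Real.exp (V / 2))
    exact squeeze_zero' (Eventually.of_forall fun n => norm_nonneg _)
      ((eventually_gt_atTop 0).mono hbound) h0
  have h2 := hlim.mul_const (Complex.exp (M * Complex.I - V / 2))
  rw [one_mul] at h2
  refine h2.congr fun n => ?_
  rw [mul_assoc, ← Complex.exp_add, neg_add_cancel, Complex.exp_zero, mul_one]

end CharacteristicFunction

section LevyConvergence

variable {k : ℕ} {μ : Measure (Matrix (Fin n) (Fin n) ℝ)}

/-- The normalized traces `Tr(U ^ j) / √j` for `j = 1, …, k`, as a vector of Euclidean space. -/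
def traceVector (k : ℕ) (U : Matrix (Fin n) (Fin n) ℝ) : EuclideanSpace ℝ (Fin k) :=
  WithLp.toLp 2 fun j => trace (U ^ ((j : ℕ) + 1)) / Real.sqrt ((j : ℕ) + 1)

lemma continuous_traceVector (k : ℕ) :
    Continuous (traceVector k : Matrix (Fin n) (Fin n) ℝ → EuclideanSpace ℝ (Fin k)) := by
  unfold traceVector
  fun_prop

lemma inner_traceVector (t : EuclideanSpace ℝ (Fin k)) (U : Matrix (Fin n) (Fin n) ℝ) :
    inner ℝ (traceVector k U) t =
      traceComb (fun j : Fin k => t j / Real.sqrt ((j : ℕ) + 1)) U := by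
  simp only [traceVector, traceComb, powerTrace, PiLp.inner_apply]
  refine Finset.sum_congr rfl fun j _ => ?_
  simp
  ring

lemma charFun_map_traceVector (t : EuclideanSpace ℝ (Fin k)) :
    charFun (μ.map (traceVector k)) t =
      ∫ U, Complex.exp (traceComb (fun j : Fin k => t j / Real.sqrt ((j : ℕ) + 1)) U *
        Complex.I) ∂μ := by
  rw [charFun_apply, integral_map (continuous_traceVector k).aemeasurable
    (Continuous.aestronglyMeasurable (by fun_prop))]
  simp only [inner_traceVector]

/-- The product of the Gaussian measures with means `η_j / √j` and variance `1`, `j = 1, …, k`,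
on Euclidean space. -/
def limitGaussian (k : ℕ) : Measure (EuclideanSpace ℝ (Fin k)) :=
  (Measure.pi fun j : Fin k =>
    gaussianReal (eta ((j : ℕ) + 1) / Real.sqrt ((j : ℕ) + 1)) 1).map (WithLp.toLp 2)

instance isProbabilityMeasure_limitGaussian (k : ℕ) : IsProbabilityMeasure (limitGaussian k) :=
  Measure.isProbabilityMeasure_map (by fun_prop)

lemma charFun_limitGaussian (t : EuclideanSpace ℝ (Fin k)) :
    charFun (limitGaussian k) t =
      Complex.exp ((∑ j : Fin k, t j / Real.sqrt ((j : ℕ) + 1) * eta (j + 1) : ℝ) * Complex.I -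
        (∑ j : Fin k, ((j : ℕ) + 1 : ℕ) * (t j / Real.sqrt ((j : ℕ) + 1)) ^ 2 : ℝ) / 2) := by
  rw [limitGaussian, charFun_pi]
  simp only [charFun_gaussianReal]
  rw [← Complex.exp_sum]
  congr 1
  rw [Complex.ofReal_sum, Complex.ofReal_sum, Finset.sum_mul, Finset.sum_div,
    ← Finset.sum_sub_distrib]
  refine Finset.sum_congr rfl fun j _ => ?_
  have h : ((j : ℕ) + 1 : ℕ) * (t j / Real.sqrt ((j : ℕ) + 1)) ^ 2 = t j ^ 2 := by
    have h0 : (0 : ℝ) < (j : ℕ) + 1 := by positivity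
    rw [div_pow, Real.sq_sqrt h0.le]
    push_cast
    field_simp
  rw [h]
  push_cast
  ring

end LevyConvergence

/-- **Diaconis–Shahshahani for O(n).**  If `U_n` is Haar distributed on `O(n)`, then for
every fixed `k`, the vector `(Tr U_n, Tr U_n² / √2, …, Tr U_n^k / √k)` converges in
distribution, as `n → ∞`, to `(N₁ + η₁, N₂ + η₂/√2, …, N_k + η_k/√k)`, where the `N_j`
are independent standard real Gaussians; the limit law is the product of the Gaussian
measures on `ℝ` with mean `η_j/√j` and variance `1`. -/
theorem trace_powers_orthogonal_tendsto_gaussian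
    (μ : ∀ n, Measure (Matrix (Fin n) (Fin n) ℝ))
    (hμ : ∀ n, IsHaarON n (μ n)) (k : ℕ) :
    ∀ g : BoundedContinuousFunction (Fin k → ℝ) ℝ,
      Tendsto
        (fun n => ∫ U, g (fun j : Fin k =>
            Matrix.trace (U ^ ((j : ℕ) + 1)) / Real.sqrt ((j : ℕ) + 1)) ∂(μ n))
        atTop
        (𝓝 (∫ x, g x ∂(Measure.pi fun j : Fin k =>
            gaussianReal (eta ((j : ℕ) + 1) / Real.sqrt ((j : ℕ) + 1)) 1))) := by
  intro g
  have hprob (n : ℕ) : IsProbabilityMeasure ((μ n).map (traceVector k)) :=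
    have := (hμ n).1
    Measure.isProbabilityMeasure_map (continuous_traceVector k).aemeasurable
  let P (n : ℕ) : ProbabilityMeasure (EuclideanSpace ℝ (Fin k)) := ⟨_, hprob n⟩
  have hP : Tendsto P atTop (𝓝 ⟨limitGaussian k, isProbabilityMeasure_limitGaussian k⟩) := by
    refine ProbabilityMeasure.tendsto_of_tendsto_charFun fun t => ?_
    simp only [P, ProbabilityMeasure.coe_mk, charFun_map_traceVector, charFun_limitGaussian]
    exact tendsto_integral_cexp_traceComb μ hμ _
  have hofLp : Continuous (WithLp.ofLp : EuclideanSpace ℝ (Fin k) → Fin k → ℝ) := by fun_prop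
  have h := ProbabilityMeasure.tendsto_iff_forall_integral_tendsto.1 hP
    (g.compContinuous ⟨_, hofLp⟩)
  have hcont : Continuous fun x : EuclideanSpace ℝ (Fin k) => g (WithLp.ofLp x) :=
    g.continuous.comp hofLp
  simp only [P, ProbabilityMeasure.coe_mk, BoundedContinuousFunction.compContinuous_apply,
    ContinuousMap.coe_mk, limitGaussian] at h
  rw [integral_map (by fun_prop) hcont.aestronglyMeasurable] at h
  refine h.congr fun n => ?_
  rw [integral_map (continuous_traceVector k).aemeasurable hcont.aestronglyMeasurable]
  rfl
end
end

section
/- Let U_n be Haar distributed on the compact symplectic group Sp(2n). Then for every fixed k ∈ ℕ, the random vector (Tr(U_n), Tr(U_n²)/√2, …, Tr(U_n^k)/√k) converges in distribution, as n → ∞, to (N_1 − η_1, N_2 − η_2/√2, …, N_k − η_k/√k), where N_1, …, N_k are independent standard real Gaussian random variables and η_j := 1 if j is even and η_j := 0 if j is odd. -/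
open MeasureTheory ProbabilityTheory Matrix Filter Topology

noncomputable section

/-- The standard symplectic form matrix `J = [[0, Iₙ], [−Iₙ, 0]]`, of size `2n × 2n`
(indexed by `Fin n ⊕ Fin n`). -/
def sympJ (n : ℕ) : Matrix (Fin n ⊕ Fin n) (Fin n ⊕ Fin n) ℂ :=
  Matrix.fromBlocks 0 1 (-1) 0

/-- Membership in the compact symplectic group `Sp(2n)`: a `2n × 2n` complex unitary
matrix `U` with `U J Uᵀ = Uᵀ J U = J`. -/
def InCompactSp (n : ℕ) (U : Matrix (Fin n ⊕ Fin n) (Fin n ⊕ Fin n) ℂ) : Prop :=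
  U ∈ Matrix.unitaryGroup (Fin n ⊕ Fin n) ℂ ∧
    U * sympJ n * U.transpose = sympJ n ∧ U.transpose * sympJ n * U = sympJ n

/-- `μ` is the Haar probability measure on `Sp(2n)`, viewed as a measure on the space of
complex `2n × 2n` matrices: it is a probability measure, gives zero mass to the
complement of `Sp(2n)`, and is invariant under left translation by elements of `Sp(2n)`. -/
def IsHaarSp (n : ℕ) (μ : Measure (Matrix (Fin n ⊕ Fin n) (Fin n ⊕ Fin n) ℂ)) : Prop :=
  IsProbabilityMeasure μ ∧
  μ {U | ¬ InCompactSp n U} = 0 ∧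
  ∀ V, InCompactSp n V → Measure.map (fun U => V * U) μ = μ

lemma sympJ_mul_sympJ (n : ℕ) : sympJ n * sympJ n = -1 := by
  simp [sympJ, Matrix.fromBlocks_multiply, ← Matrix.fromBlocks_one, Matrix.fromBlocks_neg]

lemma sympJ_transpose (n : ℕ) : (sympJ n)ᵀ = -sympJ n := by
  simp [sympJ, Matrix.fromBlocks_transpose, Matrix.fromBlocks_neg]

section CompactSp

variable {n : ℕ} {U V : Matrix (Fin n ⊕ Fin n) (Fin n ⊕ Fin n) ℂ}

/-- For a unitary matrix, one of the two symplectic relations implies the other. -/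
lemma InCompactSp.of_mul_mul_transpose (hU : U ∈ Matrix.unitaryGroup (Fin n ⊕ Fin n) ℂ)
    (h : U * sympJ n * Uᵀ = sympJ n) : InCompactSp n U := by
  refine ⟨hU, h, ?_⟩
  have h1 : U * (-(sympJ n * Uᵀ * sympJ n)) = 1 := by
    rw [mul_neg, ← mul_assoc, ← mul_assoc, h, sympJ_mul_sympJ, neg_neg]
  have h2 := mul_eq_one_comm.1 h1
  calc Uᵀ * sympJ n * U = sympJ n * (-(sympJ n * Uᵀ * sympJ n) * U) := by
        rw [neg_mul, mul_neg, ← mul_assoc, ← mul_assoc, ← mul_assoc, sympJ_mul_sympJ]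
        simp
    _ = sympJ n := by rw [h2, mul_one]

lemma InCompactSp.conjTranspose_mul_self (hU : InCompactSp n U) : Uᴴ * U = 1 :=
  Matrix.mem_unitaryGroup_iff'.1 hU.1

lemma InCompactSp.mul_conjTranspose_self (hU : InCompactSp n U) : U * Uᴴ = 1 :=
  Matrix.mem_unitaryGroup_iff.1 hU.1

lemma inCompactSp_one (n : ℕ) : InCompactSp n 1 :=
  .of_mul_mul_transpose (one_mem _) (by simp)

lemma InCompactSp.mul (hU : InCompactSp n U) (hV : InCompactSp n V) : InCompactSp n (U * V) := by
  refine .of_mul_mul_transpose (mul_mem hU.1 hV.1) ?_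
  calc U * V * sympJ n * (U * V)ᵀ = U * (V * sympJ n * Vᵀ) * Uᵀ := by
        rw [Matrix.transpose_mul]; simp only [mul_assoc]
    _ = sympJ n := by rw [hV.2.1, hU.2.1]

lemma InCompactSp.pow (hU : InCompactSp n U) (k : ℕ) : InCompactSp n (U ^ k) := by
  induction k with
  | zero => simpa using inCompactSp_one n
  | succ k ih => rw [pow_succ]; exact ih.mul hU

lemma InCompactSp.sympJ_mul_transpose_mul_sympJ (hU : InCompactSp n U) :
    sympJ n * Uᵀ * sympJ n = -Uᴴ := by
  calc sympJ n * Uᵀ * sympJ n = Uᴴ * (U * sympJ n * Uᵀ) * sympJ n := by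
        simp only [← mul_assoc]; rw [hU.conjTranspose_mul_self, one_mul]
    _ = -Uᴴ := by rw [hU.2.1, mul_assoc, sympJ_mul_sympJ]; simp

lemma InCompactSp.trace_conjTranspose (hU : InCompactSp n U) :
    Matrix.trace Uᴴ = Matrix.trace U := by
  have h := congrArg Matrix.trace hU.sympJ_mul_transpose_mul_sympJ
  rw [Matrix.trace_mul_comm, ← mul_assoc, sympJ_mul_sympJ] at h
  simpa using h.symm

lemma InCompactSp.ofReal_re_trace (hU : InCompactSp n U) :
    ((Matrix.trace U).re : ℂ) = Matrix.trace U := by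
  rw [← Complex.conj_eq_iff_re]
  simpa [Matrix.trace_conjTranspose] using hU.trace_conjTranspose

lemma InCompactSp.norm_trace_le (hU : InCompactSp n U) : ‖Matrix.trace U‖ ≤ 2 * n := by
  calc ‖Matrix.trace U‖ ≤ ∑ i, ‖U i i‖ := norm_sum_le _ _
    _ ≤ ∑ i : Fin n ⊕ Fin n, (1 : ℝ) :=
        Finset.sum_le_sum fun i _ => entry_norm_bound_of_unitary hU.1 i i
    _ = 2 * n := by simp; ring

/-- On `Sp(2n)`, the trace of `U ^ j * (Uᴴ) ^ l` only depends on `|j - l|`. -/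
lemma InCompactSp.trace_pow_mul_conjTranspose_pow (hU : InCompactSp n U) (j l : ℕ) :
    Matrix.trace (U ^ j * Uᴴ ^ l) = Matrix.trace (U ^ (j - l + (l - j))) := by
  have key (m d : ℕ) : U ^ (m + d) * Uᴴ ^ m = U ^ d := by
    induction m with
    | zero => simp
    | succ m ih =>
      rw [show m + 1 + d = (m + d) + 1 by ring, pow_succ, pow_succ', mul_assoc, ← mul_assoc U,
        hU.mul_conjTranspose_self, one_mul, ih]
  rcases le_total l j with h | h
  · obtain ⟨d, rfl⟩ := Nat.exists_eq_add_of_le h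
    rw [key, show l + d - l + (l - (l + d)) = d by omega]
  · obtain ⟨d, rfl⟩ := Nat.exists_eq_add_of_le h
    rw [show j - (j + d) + (j + d - j) = d by omega, ← (hU.pow d).trace_conjTranspose, ← key j d]
    simp [Matrix.conjTranspose_pow]

lemma isCompact_inCompactSp (n : ℕ) :
    IsCompact {U : Matrix (Fin n ⊕ Fin n) (Fin n ⊕ Fin n) ℂ | InCompactSp n U} := by
  have hball : IsCompact (Set.pi Set.univ fun _ : Fin n ⊕ Fin n =>
      Set.pi Set.univ fun _ : Fin n ⊕ Fin n => Metric.closedBall (0 : ℂ) 1) :=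
    isCompact_univ_pi fun _ => isCompact_univ_pi fun _ => isCompact_closedBall _ _
  refine hball.of_isClosed_subset ?_ fun U hU i _ j _ => ?_
  · have : {U | InCompactSp n U} = {U | Uᴴ * U = 1} ∩ ({U | U * sympJ n * Uᵀ = sympJ n} ∩
        {U | Uᵀ * sympJ n * U = sympJ n}) := by
      ext U
      simp only [InCompactSp, Matrix.mem_unitaryGroup_iff', Set.mem_ofPred_eq, Set.mem_inter_iff]
      rfl
    rw [this]
    refine (isClosed_eq (by fun_prop) (by fun_prop)).inter
      ((isClosed_eq (by fun_prop) (by fun_prop)).inter (isClosed_eq (by fun_prop) (by fun_prop)))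
  · simpa using entry_norm_bound_of_unitary hU.1 i j

/-- Exponentials of elements of the Lie algebra of `Sp(2n)` lie in `Sp(2n)`. -/
lemma inCompactSp_exp {X : Matrix (Fin n ⊕ Fin n) (Fin n ⊕ Fin n) ℂ} (hX : Xᴴ = -X)
    (hXJ : X * sympJ n + sympJ n * Xᵀ = 0) : InCompactSp n (NormedSpace.exp X) := by
  have hinv : NormedSpace.exp X * NormedSpace.exp (-X) = 1 := by
    rw [← Matrix.exp_add_of_commute _ _ (Commute.refl X).neg_right]; simp
  refine .of_mul_mul_transpose ?_ ?_
  · rw [Matrix.mem_unitaryGroup_iff, Matrix.star_eq_conjTranspose, ← Matrix.exp_conjTranspose, hX,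
      hinv]
  · have hJinv : (sympJ n)⁻¹ = -sympJ n :=
      Matrix.inv_eq_right_inv (by rw [mul_neg, sympJ_mul_sympJ, neg_neg])
    have hJ : IsUnit (sympJ n) :=
      IsUnit.of_mul_eq_one (-sympJ n) (by rw [mul_neg, sympJ_mul_sympJ, neg_neg])
    have hT : Xᵀ = sympJ n * (-X) * (sympJ n)⁻¹ := by
      have h : sympJ n * Xᵀ = -(X * sympJ n) := by
        rw [eq_neg_iff_add_eq_zero, add_comm, hXJ]
      have h2 : -Xᵀ = sympJ n * (sympJ n * Xᵀ) := by
        rw [← mul_assoc, sympJ_mul_sympJ]; simp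
      rw [hJinv, ← neg_neg Xᵀ, h2, h]
      simp [mul_assoc]
    rw [← Matrix.exp_transpose, hT, Matrix.exp_conj _ _ hJ, hJinv, mul_assoc, ← mul_assoc (sympJ n),
      ← mul_assoc (sympJ n), sympJ_mul_sympJ]
    simp [hinv, ← mul_assoc]

end CompactSp

section LieDerivative

open scoped Matrix.Norms.Operator

variable {n : ℕ}

lemma borelSpace_matrix_s1 (n : ℕ) : BorelSpace (Matrix (Fin n ⊕ Fin n) (Fin n ⊕ Fin n) ℂ) :=
  inferInstanceAs (BorelSpace ((Fin n ⊕ Fin n) → (Fin n ⊕ Fin n) → ℂ))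

/-- `D` is the derivative of `F` along the left action of the one-parameter group generated
by `X`. -/
def HasLieDeriv (X : Matrix (Fin n ⊕ Fin n) (Fin n ⊕ Fin n) ℂ)
    (F D : Matrix (Fin n ⊕ Fin n) (Fin n ⊕ Fin n) ℂ → ℂ) : Prop :=
  ∀ V, HasDerivAt (fun t : ℝ => F (NormedSpace.exp (t • X) * V)) (D V) 0

lemma integrable_of_continuous {μ : Measure (Matrix (Fin n ⊕ Fin n) (Fin n ⊕ Fin n) ℂ)}
    (hμ : IsHaarSp n μ) {F : Matrix (Fin n ⊕ Fin n) (Fin n ⊕ Fin n) ℂ → ℂ} (hF : Continuous F) :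
    Integrable F μ := by
  have := hμ.1
  have := borelSpace_matrix_s1 n
  obtain ⟨C, hC⟩ := (isCompact_inCompactSp n).exists_bound_of_continuousOn hF.continuousOn
  have hae : ∀ᵐ U ∂μ, InCompactSp n U := hμ.2.1
  exact Integrable.mono' (integrable_const C) hF.measurable.aestronglyMeasurable
    (hae.mono fun U hU => hC U hU)

lemma HasLieDeriv.hasDerivAt {X : Matrix (Fin n ⊕ Fin n) (Fin n ⊕ Fin n) ℂ}
    {F D : Matrix (Fin n ⊕ Fin n) (Fin n ⊕ Fin n) ℂ → ℂ} (h : HasLieDeriv X F D)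
    (V : Matrix (Fin n ⊕ Fin n) (Fin n ⊕ Fin n) ℂ) (t : ℝ) :
    HasDerivAt (fun t : ℝ => F (NormedSpace.exp (t • X) * V))
      (D (NormedSpace.exp (t • X) * V)) t := by
  have h1 := h (NormedSpace.exp (t • X) * V)
  have h2 : HasDerivAt (fun s : ℝ => s - t) 1 t := (hasDerivAt_id t).sub_const t
  have h3 := HasDerivAt.scomp_of_eq (g₁ := fun s : ℝ => F (NormedSpace.exp (s • X) *
    (NormedSpace.exp (t • X) * V))) t h1 h2 (by simp)
  rw [one_smul] at h3
  refine h3.congr_of_eventuallyEq (Filter.Eventually.of_forall fun s => ?_)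
  have hc : Commute ((s - t) • X) (t • X) := ((Commute.refl X).smul_left _).smul_right _
  simp only [Function.comp]
  rw [← mul_assoc, ← Matrix.exp_add_of_commute _ _ hc, ← add_smul, sub_add_cancel]

/-- Infinitesimal invariance of the Haar measure. -/
lemma integral_lieDeriv_eq_zero {μ : Measure (Matrix (Fin n ⊕ Fin n) (Fin n ⊕ Fin n) ℂ)}
    (hμ : IsHaarSp n μ) {X : Matrix (Fin n ⊕ Fin n) (Fin n ⊕ Fin n) ℂ} (hX : Xᴴ = -X)
    (hXJ : X * sympJ n + sympJ n * Xᵀ = 0)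
    {F D : Matrix (Fin n ⊕ Fin n) (Fin n ⊕ Fin n) ℂ → ℂ} (hF : Continuous F) (hD : Continuous D)
    (h : HasLieDeriv X F D) : ∫ V, D V ∂μ = 0 := by
  have := hμ.1
  have := borelSpace_matrix_s1 n
  have hsp (t : ℝ) : InCompactSp n (NormedSpace.exp (t • X)) := by
    refine inCompactSp_exp (by simp [Matrix.conjTranspose_smul, hX]) ?_
    rw [Matrix.transpose_smul, Matrix.smul_mul, Matrix.mul_smul, ← smul_add, hXJ, smul_zero]
  have hae : ∀ᵐ U ∂μ, InCompactSp n U := hμ.2.1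
  obtain ⟨C, hC⟩ := (isCompact_inCompactSp n).exists_bound_of_continuousOn hD.continuousOn
  have hmul (A : Matrix (Fin n ⊕ Fin n) (Fin n ⊕ Fin n) ℂ) : Continuous fun V => A * V := by
    fun_prop
  have hder := (hasDerivAt_integral_of_dominated_loc_of_deriv_le (μ := μ)
    (F := fun (t : ℝ) V => F (NormedSpace.exp (t • X) * V))
    (F' := fun (t : ℝ) V => D (NormedSpace.exp (t • X) * V)) (x₀ := 0) (s := Set.univ)
    (bound := fun _ => C) Filter.univ_mem
    (Filter.Eventually.of_forall fun t => (hF.comp (hmul _)).measurable.aestronglyMeasurable)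
    (integrable_of_continuous hμ (hF.comp (hmul _)))
    (hD.comp (hmul _)).measurable.aestronglyMeasurable
    (hae.mono fun V hV t _ => hC _ ((hsp t).mul hV)) (integrable_const C)
    (Filter.Eventually.of_forall fun V t _ => h.hasDerivAt V t)).2
  have hconst : (fun t : ℝ => ∫ V, F (NormedSpace.exp (t • X) * V) ∂μ) =
      fun _ => ∫ V, F V ∂μ := by
    funext t
    conv_rhs => rw [← hμ.2.2 _ (hsp t)]
    rw [integral_map (hmul _).measurable.aemeasurable hF.measurable.aestronglyMeasurable]
  rw [hconst] at hder
  simpa using hder.unique (hasDerivAt_const _ _)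

lemma HasLieDeriv.mul {X : Matrix (Fin n ⊕ Fin n) (Fin n ⊕ Fin n) ℂ}
    {F F' D D' : Matrix (Fin n ⊕ Fin n) (Fin n ⊕ Fin n) ℂ → ℂ} (h : HasLieDeriv X F D)
    (h' : HasLieDeriv X F' D') :
    HasLieDeriv X (fun V => F V * F' V) (fun V => D V * F' V + F V * D' V) := by
  intro V
  simpa using (h V).fun_mul (h' V)

lemma HasLieDeriv.const_mul {X : Matrix (Fin n ⊕ Fin n) (Fin n ⊕ Fin n) ℂ}
    {F D : Matrix (Fin n ⊕ Fin n) (Fin n ⊕ Fin n) ℂ → ℂ} (h : HasLieDeriv X F D) (c : ℂ) :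
    HasLieDeriv X (fun V => c * F V) (fun V => c * D V) :=
  fun V => (h V).const_mul c

lemma HasLieDeriv.sum {ι : Type*} {s : Finset ι} {X : Matrix (Fin n ⊕ Fin n) (Fin n ⊕ Fin n) ℂ}
    {F D : ι → Matrix (Fin n ⊕ Fin n) (Fin n ⊕ Fin n) ℂ → ℂ}
    (h : ∀ i ∈ s, HasLieDeriv X (F i) (D i)) :
    HasLieDeriv X (fun V => ∑ i ∈ s, F i V) (fun V => ∑ i ∈ s, D i V) :=
  fun V => HasDerivAt.fun_sum fun i hi => h i hi V

lemma HasLieDeriv.cexp {X : Matrix (Fin n ⊕ Fin n) (Fin n ⊕ Fin n) ℂ}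
    {F D : Matrix (Fin n ⊕ Fin n) (Fin n ⊕ Fin n) ℂ → ℂ} (h : HasLieDeriv X F D) :
    HasLieDeriv X (fun V => Complex.exp (F V)) (fun V => Complex.exp (F V) * D V) := by
  intro V
  simpa using (h V).cexp

lemma hasDerivAt_exp_mul_pow (X V : Matrix (Fin n ⊕ Fin n) (Fin n ⊕ Fin n) ℂ) (j : ℕ) :
    HasDerivAt (fun t : ℝ => (NormedSpace.exp (t • X) * V) ^ j)
      (∑ m ∈ Finset.range j, V ^ m * X * V ^ (j - m)) 0 := by
  have h1 : HasDerivAt (fun t : ℝ => NormedSpace.exp (t • X) * V) (X * V) 0 := by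
    have h := (hasDerivAt_exp_smul_const (𝕂 := ℝ) X 0).mul_const V
    simp only [zero_smul, NormedSpace.exp_zero, one_mul] at h
    exact h
  induction j with
  | zero =>
    simp only [pow_zero, Finset.range_zero, Finset.sum_empty]
    exact hasDerivAt_const _ _
  | succ j ih =>
    simp only [pow_succ]
    convert! ih.fun_mul h1 using 1
    rw [Finset.sum_range_succ, Finset.sum_mul]
    congr 1
    · refine Finset.sum_congr rfl fun m hm => ?_
      rw [Nat.sub_add_comm (Finset.mem_range.1 hm).le, pow_succ]
      simp [mul_assoc]
    · simp [mul_assoc]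

lemma hasLieDeriv_linear_pow (L : Matrix (Fin n ⊕ Fin n) (Fin n ⊕ Fin n) ℂ →ₗ[ℂ] ℂ)
    (X : Matrix (Fin n ⊕ Fin n) (Fin n ⊕ Fin n) ℂ) (j : ℕ) :
    HasLieDeriv X (fun V => L (V ^ j))
      (fun V => ∑ m ∈ Finset.range j, L (V ^ m * X * V ^ (j - m))) := by
  intro V
  have h := ((L.restrictScalars ℝ).toContinuousLinearMap.hasFDerivAt).comp_hasDerivAt (0 : ℝ)
    (hasDerivAt_exp_mul_pow X V j)
  exact h.congr_deriv (map_sum L _ _)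

lemma hasLieDeriv_trace_pow (X : Matrix (Fin n ⊕ Fin n) (Fin n ⊕ Fin n) ℂ) (j : ℕ) :
    HasLieDeriv X (fun V => Matrix.trace (V ^ j)) (fun V => Matrix.trace (X * ((j : ℂ) • V ^ j))) := by
  have h := hasLieDeriv_linear_pow (Matrix.traceLinearMap (Fin n ⊕ Fin n) ℂ ℂ) X j
  intro V
  refine (h V).congr_deriv ?_
  simp only [Matrix.traceLinearMap_apply]
  rw [Finset.sum_congr rfl (g := fun _ => Matrix.trace (X * V ^ j))]
  · simp
  · intro m hm
    rw [mul_assoc, Matrix.trace_mul_comm, mul_assoc, ← pow_add,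
      Nat.sub_add_cancel (Finset.mem_range.1 hm).le]

end LieDerivative

section LoopEquation

variable {n : ℕ} {μ : Measure (Matrix (Fin n ⊕ Fin n) (Fin n ⊕ Fin n) ℂ)}

/-- Infinitesimal invariance of the Haar measure, extended by linearity to the complexified
Lie algebra. -/
lemma integral_lieDeriv_eq_zero_of_isLinearMap (hμ : IsHaarSp n μ)
    {X : Matrix (Fin n ⊕ Fin n) (Fin n ⊕ Fin n) ℂ} (hXJ : X * sympJ n + sympJ n * Xᵀ = 0)
    {F : Matrix (Fin n ⊕ Fin n) (Fin n ⊕ Fin n) ℂ → ℂ}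
    {D : Matrix (Fin n ⊕ Fin n) (Fin n ⊕ Fin n) ℂ → Matrix (Fin n ⊕ Fin n) (Fin n ⊕ Fin n) ℂ → ℂ}
    (hF : Continuous F) (hD : ∀ Y, Continuous (D Y)) (hlin : ∀ V, IsLinearMap ℂ fun Y => D Y V)
    (h : ∀ Y, HasLieDeriv Y F (D Y)) : ∫ V, D X V ∂μ = 0 := by
  have hJH : (sympJ n)ᴴ = -sympJ n := by
    simp [sympJ, Matrix.fromBlocks_conjTranspose, Matrix.fromBlocks_neg]
  have hX' : Xᴴ * sympJ n + sympJ n * Xᴴᵀ = 0 := by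
    have h1 := congrArg Matrix.conjTranspose hXJ
    rw [Matrix.conjTranspose_add, Matrix.conjTranspose_mul, Matrix.conjTranspose_mul, hJH,
      Matrix.conjTranspose_zero] at h1
    have h2 : Xᵀᴴ = Xᴴᵀ := rfl
    rw [h2] at h1
    calc Xᴴ * sympJ n + sympJ n * Xᴴᵀ
        = sympJ n * (-sympJ n * Xᴴ + Xᴴᵀ * -sympJ n) * sympJ n := by
          have h3 : sympJ n * (-sympJ n * Xᴴ) * sympJ n = -(sympJ n * sympJ n) * Xᴴ * sympJ n := by
            noncomm_ring
          have h4 : sympJ n * (Xᴴᵀ * -sympJ n) * sympJ n =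
              -(sympJ n * Xᴴᵀ * (sympJ n * sympJ n)) := by noncomm_ring
          rw [mul_add, add_mul, h3, h4, sympJ_mul_sympJ]
          simp
      _ = 0 := by rw [h1]; simp
  have hA := integral_lieDeriv_eq_zero hμ (X := X - Xᴴ) (by simp)
    (by rw [Matrix.transpose_sub, sub_mul, mul_sub, sub_add_sub_comm, hXJ, hX', sub_zero])
    hF (hD _) (h _)
  have hB := integral_lieDeriv_eq_zero hμ (X := Complex.I • (X + Xᴴ))
    (by simp [Matrix.conjTranspose_smul, add_comm])
    (by rw [Matrix.transpose_smul, Matrix.smul_mul, Matrix.mul_smul, ← smul_add,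
          Matrix.transpose_add, add_mul, mul_add, add_add_add_comm, hXJ, hX', add_zero, smul_zero])
    hF (hD _) (h _)
  have hdec (V) : D X V = 2⁻¹ * D (X - Xᴴ) V + -(2⁻¹ * Complex.I) * D (Complex.I • (X + Xᴴ)) V := by
    rw [(hlin V).map_sub, (hlin V).map_smul, (hlin V).map_add, smul_eq_mul]
    linear_combination ((2⁻¹ : ℂ) * (D X V + D Xᴴ V)) * Complex.I_mul_I
  simp_rw [hdec]
  rw [integral_add ((integrable_of_continuous hμ (hD _)).const_mul _)
    ((integrable_of_continuous hμ (hD _)).const_mul _), integral_const_mul, integral_const_mul,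
    hA, hB]
  simp

/-- `K` is the gradient of `G` for the trace form along the left action of the group. -/
def HasLieGrad (G : Matrix (Fin n ⊕ Fin n) (Fin n ⊕ Fin n) ℂ → ℂ)
    (K : Matrix (Fin n ⊕ Fin n) (Fin n ⊕ Fin n) ℂ → Matrix (Fin n ⊕ Fin n) (Fin n ⊕ Fin n) ℂ) :
    Prop :=
  ∀ X, HasLieDeriv X G fun V => Matrix.trace (X * K V)

lemma sum_mul_single_add_single_mul_apply {ι : Type*} [Fintype ι] [DecidableEq ι]
    (A C : Matrix ι ι ℂ) :
    ∑ a, ∑ b, (A * (Matrix.single a b 1 + Matrix.single b a 1) * C : Matrix ι ι ℂ) a b =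
      Matrix.trace A * Matrix.trace C + Matrix.trace (A * Cᵀ) := by
  have h (a b i j : ι) : (A * Matrix.single i j 1 * C : Matrix ι ι ℂ) a b = A a i * C j b := by
    rw [Matrix.mul_apply, Finset.sum_eq_single j] <;>
      simp +contextual [Matrix.mul_single_apply_of_ne]
  simp only [mul_add, add_mul, Matrix.add_apply, h, Finset.sum_add_distrib]
  simp only [Matrix.trace, Matrix.diag, Matrix.mul_apply, Matrix.transpose_apply,
    Finset.sum_mul_sum]

lemma sum_apply_mul_trace_single_add_single_mul {ι : Type*} [Fintype ι] [DecidableEq ι]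
    (A C : Matrix ι ι ℂ) :
    ∑ a, ∑ b, A a b * Matrix.trace ((Matrix.single a b 1 + Matrix.single b a 1) * C) =
      Matrix.trace (A * C) + Matrix.trace (A * Cᵀ) := by
  simp only [add_mul, Matrix.trace_add, Matrix.trace_single_mul, one_smul, mul_add,
    Finset.sum_add_distrib]
  simp only [Matrix.trace, Matrix.diag, Matrix.mul_apply, Matrix.transpose_apply]

lemma InCompactSp.sum_loop {V : Matrix (Fin n ⊕ Fin n) (Fin n ⊕ Fin n) ℂ} (hV : InCompactSp n V)
    (j : ℕ) (g : ℂ) (B : Matrix (Fin n ⊕ Fin n) (Fin n ⊕ Fin n) ℂ) :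
    ∑ a, ∑ b, ((∑ m ∈ Finset.range j, Matrix.entryLinearMap ℂ ℂ a b
        (V ^ m * ((Matrix.single a b 1 + Matrix.single b a 1) * sympJ n) * V ^ (j - m) * sympJ n))
          * g + Matrix.entryLinearMap ℂ ℂ a b (V ^ j * sympJ n) *
        Matrix.trace ((Matrix.single a b 1 + Matrix.single b a 1) * sympJ n * B)) =
      -((∑ m ∈ Finset.range j, (Matrix.trace (V ^ m) * Matrix.trace (V ^ (j - m)) +
        Matrix.trace (V ^ m * Vᴴ ^ (j - m)))) * g + Matrix.trace (V ^ j * B) +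
        Matrix.trace (V ^ j * (sympJ n * Bᵀ * sympJ n))) := by
  simp only [Finset.sum_add_distrib, ← Finset.sum_mul]
  have h1 : ∑ a, ∑ b, ∑ m ∈ Finset.range j, Matrix.entryLinearMap ℂ ℂ a b
        (V ^ m * ((Matrix.single a b 1 + Matrix.single b a 1) * sympJ n) * V ^ (j - m) * sympJ n) =
      -∑ m ∈ Finset.range j, (Matrix.trace (V ^ m) * Matrix.trace (V ^ (j - m)) +
        Matrix.trace (V ^ m * Vᴴ ^ (j - m))) := by
    rw [Finset.sum_congr rfl fun a _ => Finset.sum_comm, Finset.sum_comm, ← Finset.sum_neg_distrib]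
    refine Finset.sum_congr rfl fun m _ => ?_
    have h3 := sum_mul_single_add_single_mul_apply (V ^ m) (sympJ n * V ^ (j - m) * sympJ n)
    have h4 : (sympJ n * V ^ (j - m) * sympJ n)ᵀ = -(Vᴴ ^ (j - m)) := by
      rw [Matrix.transpose_mul, Matrix.transpose_mul, sympJ_transpose, ← Matrix.conjTranspose_pow,
        ← (hV.pow (j - m)).sympJ_mul_transpose_mul_sympJ]
      simp [mul_assoc]
    have h5 : Matrix.trace (sympJ n * V ^ (j - m) * sympJ n) = -Matrix.trace (V ^ (j - m)) := by
      rw [Matrix.trace_mul_comm, ← mul_assoc, sympJ_mul_sympJ]; simp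
    rw [h4, h5, mul_neg, mul_neg, Matrix.trace_neg, ← neg_add] at h3
    rw [← h3]
    simp only [mul_assoc, Matrix.entryLinearMap_apply]
  have h6 := sum_apply_mul_trace_single_add_single_mul (V ^ j * sympJ n) (sympJ n * B)
  have h7 : V ^ j * sympJ n * (sympJ n * B) = -(V ^ j * B) := by
    rw [mul_assoc, ← mul_assoc (sympJ n), sympJ_mul_sympJ]; simp
  have h8 : V ^ j * sympJ n * (sympJ n * B)ᵀ = -(V ^ j * (sympJ n * Bᵀ * sympJ n)) := by
    rw [Matrix.transpose_mul, sympJ_transpose]; simp [mul_assoc]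
  rw [h7, h8, Matrix.trace_neg, Matrix.trace_neg] at h6
  simp only [← mul_assoc, Matrix.entryLinearMap_apply, ← Finset.sum_add_distrib] at h6 h1 ⊢
  rw [h1, h6]
  ring

/-- The loop (Schwinger-Dyson) equation for the Haar measure of `Sp(2n)`. -/
lemma integral_loop_eq_zero (hμ : IsHaarSp n μ) (j : ℕ)
    {G : Matrix (Fin n ⊕ Fin n) (Fin n ⊕ Fin n) ℂ → ℂ}
    {K : Matrix (Fin n ⊕ Fin n) (Fin n ⊕ Fin n) ℂ → Matrix (Fin n ⊕ Fin n) (Fin n ⊕ Fin n) ℂ}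
    (hG : Continuous G) (hK : Continuous K) (h : HasLieGrad G K) :
    ∫ V, ((∑ m ∈ Finset.range j, (Matrix.trace (V ^ m) * Matrix.trace (V ^ (j - m)) +
        Matrix.trace (V ^ m * Vᴴ ^ (j - m)))) * G V + Matrix.trace (V ^ j * K V) +
        Matrix.trace (V ^ j * (sympJ n * (K V)ᵀ * sympJ n))) ∂μ = 0 := by
  let D (a b : Fin n ⊕ Fin n) (X V : Matrix (Fin n ⊕ Fin n) (Fin n ⊕ Fin n) ℂ) : ℂ :=
    (∑ m ∈ Finset.range j, Matrix.entryLinearMap ℂ ℂ a b (V ^ m * X * V ^ (j - m) * sympJ n)) * G V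
      + Matrix.entryLinearMap ℂ ℂ a b (V ^ j * sympJ n) * Matrix.trace (X * K V)
  have hentry (a b : Fin n ⊕ Fin n) : Continuous (Matrix.entryLinearMap ℂ ℂ a b) :=
    Continuous.matrix_elem continuous_id a b
  have hpow : Continuous fun V : Matrix (Fin n ⊕ Fin n) (Fin n ⊕ Fin n) ℂ => V ^ j * sympJ n :=
    (continuous_pow j).mul continuous_const
  have hDcont (a b X) : Continuous (D a b X) := by
    have h1 (m : ℕ) : Continuous fun V : Matrix (Fin n ⊕ Fin n) (Fin n ⊕ Fin n) ℂ =>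
        V ^ m * X * V ^ (j - m) * sympJ n :=
      (((continuous_pow m).mul continuous_const).mul (continuous_pow (j - m))).mul continuous_const
    have h2 : Continuous fun V => Matrix.trace (X * K V) :=
      (continuous_const.mul hK).matrix_trace
    exact ((continuous_finsetSum _ fun m _ => (hentry a b).comp (h1 m)).mul hG).add
      (((hentry a b).comp hpow).mul h2)
  have hlin (a b V) : IsLinearMap ℂ fun X => D a b X V := by
    constructor
    · intro X Y
      simp only [D, mul_add, add_mul, map_add, Finset.sum_add_distrib, Matrix.trace_add]
      ring
    · intro c X
      simp only [D, Matrix.mul_smul, Matrix.smul_mul, map_smul, Matrix.trace_smul,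
        smul_eq_mul, ← Finset.mul_sum]
      ring
  have hzero (a b) :
      ∫ V, D a b ((Matrix.single a b 1 + Matrix.single b a 1) * sympJ n) V ∂μ = 0 := by
    refine integral_lieDeriv_eq_zero_of_isLinearMap hμ
      (F := fun V => Matrix.entryLinearMap ℂ ℂ a b (V ^ j * sympJ n) * G V) ?_
      (((hentry a b).comp hpow).mul hG) (hDcont a b) (hlin a b) fun Y => ?_
    · rw [Matrix.transpose_mul, sympJ_transpose, mul_assoc, sympJ_mul_sympJ, ← mul_assoc, mul_neg,
        mul_neg, sympJ_mul_sympJ, Matrix.transpose_add, Matrix.transpose_single,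
        Matrix.transpose_single, mul_one, neg_neg, one_mul]
      abel
    · exact (hasLieDeriv_linear_pow
        (Matrix.entryLinearMap ℂ ℂ a b ∘ₗ LinearMap.mulRight ℂ (sympJ n)) Y j).mul (h Y)
  have hsum : ∫ V, ∑ a, ∑ b, D a b ((Matrix.single a b 1 + Matrix.single b a 1) * sympJ n) V ∂μ
      = 0 := by
    rw [integral_finsetSum _ fun a _ => integrable_finsetSum _ fun b _ =>
      integrable_of_continuous hμ (hDcont a b _)]
    refine Finset.sum_eq_zero fun a _ => ?_
    rw [integral_finsetSum _ fun b _ => integrable_of_continuous hμ (hDcont a b _)]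
    exact Finset.sum_eq_zero fun b _ => hzero a b
  have hae : ∀ᵐ U ∂μ, InCompactSp n U := hμ.2.1
  rw [← neg_eq_zero, ← integral_neg, ← hsum]
  exact integral_congr_ae (hae.mono fun V hV => (hV.sum_loop j (G V) (K V)).symm)

end LoopEquation

section TracePowers

variable {n : ℕ} {μ : Measure (Matrix (Fin n ⊕ Fin n) (Fin n ⊕ Fin n) ℂ)}

/-- The power sum `Tr (V ^ j)`. -/
def trPow (j : ℕ) (V : Matrix (Fin n ⊕ Fin n) (Fin n ⊕ Fin n) ℂ) : ℂ := Matrix.trace (V ^ j)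

/-- The power sum of index `|a - b|`, replaced by `0` when `a = b`. -/
def offDiagTrPow (a b : ℕ) (V : Matrix (Fin n ⊕ Fin n) (Fin n ⊕ Fin n) ℂ) : ℂ :=
  if a = b then 0 else trPow (a - b + (b - a)) V

lemma continuous_trPow (j : ℕ) :
    Continuous (trPow j : Matrix (Fin n ⊕ Fin n) (Fin n ⊕ Fin n) ℂ → ℂ) :=
  (continuous_pow j).matrix_trace

lemma continuous_offDiagTrPow (a b : ℕ) :
    Continuous (offDiagTrPow a b : Matrix (Fin n ⊕ Fin n) (Fin n ⊕ Fin n) ℂ → ℂ) := by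
  unfold offDiagTrPow
  split_ifs
  · exact continuous_const
  · exact continuous_trPow _

lemma InCompactSp.norm_trPow_le {V : Matrix (Fin n ⊕ Fin n) (Fin n ⊕ Fin n) ℂ}
    (hV : InCompactSp n V) (j : ℕ) : ‖trPow j V‖ ≤ 2 * n :=
  (hV.pow j).norm_trace_le

lemma InCompactSp.norm_offDiagTrPow_le {V : Matrix (Fin n ⊕ Fin n) (Fin n ⊕ Fin n) ℂ}
    (hV : InCompactSp n V) (a b : ℕ) : ‖offDiagTrPow a b V‖ ≤ 2 * n := by
  unfold offDiagTrPow
  split_ifs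
  · simp
  · exact hV.norm_trPow_le _

lemma InCompactSp.ofReal_re_trPow {V : Matrix (Fin n ⊕ Fin n) (Fin n ⊕ Fin n) ℂ}
    (hV : InCompactSp n V) (j : ℕ) : ((trPow j V).re : ℂ) = trPow j V :=
  (hV.pow j).ofReal_re_trace

lemma InCompactSp.trace_pow_mul_conjTranspose_pow_eq
    {V : Matrix (Fin n ⊕ Fin n) (Fin n ⊕ Fin n) ℂ} (hV : InCompactSp n V) (a b : ℕ) :
    Matrix.trace (V ^ a * Vᴴ ^ b) = offDiagTrPow a b V + if a = b then 2 * (n : ℂ) else 0 := by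
  rw [hV.trace_pow_mul_conjTranspose_pow]
  unfold offDiagTrPow
  split_ifs with h
  · subst h; simp; ring
  · simp [trPow]

lemma sum_range_ite_succ_eq_sub (j : ℕ) (x : ℂ) :
    ∑ m ∈ Finset.range j, (if m + 1 = j - m then x else 0) = eta (j + 1) * x := by
  unfold eta
  split_ifs with h
  · obtain ⟨r, hr⟩ := h
    rw [Finset.sum_eq_single (r - 1)]
    · rw [if_pos (by omega)]; simp
    · intro m hm hne
      rw [if_neg (by omega)]
    · intro hr'
      simp only [Finset.mem_range] at hr'
      omega
  · rw [Finset.sum_eq_zero]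
    · simp
    · intro m hm
      rw [if_neg]
      rintro h'
      exact h ⟨m + 1, by have := Finset.mem_range.1 hm; omega⟩

/-- The loop equation in terms of power sums. -/
lemma integral_trPow_mul {ι : Type*} (hμ : IsHaarSp n μ) (j : ℕ) (s : Finset ι) (c : ι → ℂ)
    (e : ι → ℕ) {G g : Matrix (Fin n ⊕ Fin n) (Fin n ⊕ Fin n) ℂ → ℂ} (hG : Continuous G)
    (hg : Continuous g) (h : HasLieGrad G fun V => ∑ l ∈ s, (c l * g V) • V ^ e l) :
    (2 * n + 1) * ∫ V, trPow (j + 1) V * G V ∂μ =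
      -∫ V, (∑ m ∈ Finset.range j, (trPow (m + 1) V * trPow (j - m) V +
          offDiagTrPow (m + 1) (j - m) V)) * G V ∂μ
        - eta (j + 1) * (2 * n) * ∫ V, G V ∂μ +
      ∑ l ∈ s, c l * (∫ V, (offDiagTrPow (j + 1) (e l) V - trPow (j + 1 + e l) V) * g V ∂μ +
        (if j + 1 = e l then 2 * (n : ℂ) else 0) * ∫ V, g V ∂μ) := by
  have hae : ∀ᵐ U ∂μ, InCompactSp n U := hμ.2.1
  have hK : Continuous fun V : Matrix (Fin n ⊕ Fin n) (Fin n ⊕ Fin n) ℂ =>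
      ∑ l ∈ s, (c l * g V) • V ^ e l :=
    continuous_finsetSum _ fun l _ => (continuous_const.mul hg).smul (continuous_pow _)
  have hloop := integral_loop_eq_zero hμ (j + 1) hG hK h
  set S : Matrix (Fin n ⊕ Fin n) (Fin n ⊕ Fin n) ℂ → ℂ := fun V =>
    ∑ m ∈ Finset.range j, (trPow (m + 1) V * trPow (j - m) V +
          offDiagTrPow (m + 1) (j - m) V) with hS
  have hScont : Continuous S := continuous_finsetSum _ fun m _ =>
    ((continuous_trPow _).mul (continuous_trPow _)).add (continuous_offDiagTrPow _ _)
  have hTcont (l : ι) : Continuous fun V : Matrix (Fin n ⊕ Fin n) (Fin n ⊕ Fin n) ℂ =>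
      (offDiagTrPow (j + 1) (e l) V - trPow (j + 1 + e l) V) * g V :=
    ((continuous_offDiagTrPow _ _).sub (continuous_trPow _)).mul hg
  have i1 : Integrable (fun V => (2 * (n : ℂ) + 1) * (trPow (j + 1) V * G V)) μ :=
    (integrable_of_continuous hμ ((continuous_trPow (j + 1)).mul hG)).const_mul _
  have i2 : Integrable (fun V => S V * G V) μ := integrable_of_continuous hμ (hScont.mul hG)
  have i12 : Integrable (fun V => (2 * (n : ℂ) + 1) * (trPow (j + 1) V * G V) + S V * G V) μ :=
    i1.add i2
  have i3 : Integrable (fun V => (eta (j + 1) : ℂ) * (2 * n) * G V) μ :=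
    (integrable_of_continuous hμ hG).const_mul _
  have i123 : Integrable (fun V => (2 * (n : ℂ) + 1) * (trPow (j + 1) V * G V) + S V * G V +
      (eta (j + 1) : ℂ) * (2 * n) * G V) μ := i12.add i3
  have i4 (l : ι) : Integrable (fun V =>
      (offDiagTrPow (j + 1) (e l) V - trPow (j + 1 + e l) V) * g V) μ :=
    integrable_of_continuous hμ (hTcont l)
  have i5 (l : ι) : Integrable (fun V => (if j + 1 = e l then 2 * (n : ℂ) else 0) * g V) μ :=
    (integrable_of_continuous hμ hg).const_mul _
  have i45 (l : ι) : Integrable (fun V => c l *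
      ((offDiagTrPow (j + 1) (e l) V - trPow (j + 1 + e l) V) * g V +
        (if j + 1 = e l then 2 * (n : ℂ) else 0) * g V)) μ := ((i4 l).add (i5 l)).const_mul (c l)
  have i6 : Integrable (fun V => ∑ l ∈ s, c l *
      ((offDiagTrPow (j + 1) (e l) V - trPow (j + 1 + e l) V) * g V +
        (if j + 1 = e l then 2 * (n : ℂ) else 0) * g V)) μ :=
    integrable_finsetSum s fun l _ => i45 l
  have hpt : ∀ᵐ V ∂μ, (∑ m ∈ Finset.range (j + 1), (Matrix.trace (V ^ m) *
        Matrix.trace (V ^ (j + 1 - m)) + Matrix.trace (V ^ m * Vᴴ ^ (j + 1 - m)))) * G V +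
        Matrix.trace (V ^ (j + 1) * ∑ l ∈ s, (c l * g V) • V ^ e l) +
        Matrix.trace (V ^ (j + 1) * (sympJ n * (∑ l ∈ s, (c l * g V) • V ^ e l)ᵀ * sympJ n)) =
      ((2 * (n : ℂ) + 1) * (trPow (j + 1) V * G V) + S V * G V +
        (eta (j + 1) : ℂ) * (2 * n) * G V) -
        ∑ l ∈ s, c l * ((offDiagTrPow (j + 1) (e l) V - trPow (j + 1 + e l) V) * g V +
        (if j + 1 = e l then 2 * (n : ℂ) else 0) * g V) := by
    filter_upwards [hae] with V hV
    have h1 : ∑ m ∈ Finset.range (j + 1), (Matrix.trace (V ^ m) *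
        Matrix.trace (V ^ (j + 1 - m)) + Matrix.trace (V ^ m * Vᴴ ^ (j + 1 - m))) =
        S V + eta (j + 1) * (2 * n) + (2 * n + 1) * trPow (j + 1) V := by
      rw [Finset.sum_range_succ']
      congr 1
      · rw [← sum_range_ite_succ_eq_sub, hS, ← Finset.sum_add_distrib]
        refine Finset.sum_congr rfl fun m _ => ?_
        rw [hV.trace_pow_mul_conjTranspose_pow_eq, Nat.add_sub_add_right]
        simp only [trPow]; ring
      · rw [pow_zero, one_mul, tsub_zero, ← Matrix.conjTranspose_pow,
          (hV.pow _).trace_conjTranspose]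
        simp [trPow]; ring
    have h2 : Matrix.trace (V ^ (j + 1) * ∑ l ∈ s, (c l * g V) • V ^ e l) =
        ∑ l ∈ s, c l * g V * trPow (j + 1 + e l) V := by
      simp [Finset.mul_sum, Matrix.trace_sum, trPow, pow_add]
    have h3 : Matrix.trace (V ^ (j + 1) * (sympJ n * (∑ l ∈ s, (c l * g V) • V ^ e l)ᵀ * sympJ n))
        = ∑ l ∈ s, -(c l * g V * (offDiagTrPow (j + 1) (e l) V +
          if j + 1 = e l then 2 * (n : ℂ) else 0)) := by
      rw [Matrix.transpose_sum, Finset.mul_sum, Finset.sum_mul, Finset.mul_sum, Matrix.trace_sum]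
      refine Finset.sum_congr rfl fun l _ => ?_
      rw [Matrix.transpose_smul, Matrix.mul_smul, Matrix.smul_mul,
        (hV.pow _).sympJ_mul_transpose_mul_sympJ, Matrix.conjTranspose_pow, Matrix.mul_smul,
        mul_neg, Matrix.trace_smul, Matrix.trace_neg, hV.trace_pow_mul_conjTranspose_pow_eq,
        smul_eq_mul]
      ring
    rw [h1, h2, h3, add_assoc, ← Finset.sum_add_distrib, sub_eq_add_neg, ← Finset.sum_neg_distrib]
    congr 1
    · ring
    · exact Finset.sum_congr rfl fun l _ => by ring
  rw [integral_congr_ae hpt, integral_sub i123 i6, integral_add i12 i3,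
    integral_add i1 i2, integral_const_mul, integral_const_mul,
    integral_finsetSum _ fun l _ => i45 l] at hloop
  simp_rw [integral_const_mul, integral_add (i4 _) (i5 _), integral_const_mul] at hloop
  linear_combination hloop

lemma hasLieGrad_trPow (j : ℕ) :
    HasLieGrad (n := n) (trPow j) fun V => ∑ l ∈ {j}, ((j : ℂ) * 1) • V ^ l := by
  intro X
  change HasLieDeriv X (fun V => Matrix.trace (V ^ j)) _
  simpa using hasLieDeriv_trace_pow X j

lemma hasLieGrad_cexp_sum_trPow {ι : Type*} (s : Finset ι) (a : ι → ℂ) (e : ι → ℕ) :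
    HasLieGrad (n := n) (fun V => Complex.exp (∑ l ∈ s, a l * trPow (e l) V))
      fun V => ∑ l ∈ s, (a l * e l * Complex.exp (∑ l ∈ s, a l * trPow (e l) V)) • V ^ e l := by
  intro X
  have h := (HasLieDeriv.sum (s := s) fun l _ =>
    (hasLieDeriv_trace_pow X (e l)).const_mul (a l)).cexp
  intro V
  refine (h V).congr_deriv ?_
  beta_reduce
  rw [Finset.mul_sum, Finset.mul_sum, Matrix.trace_sum]
  refine Finset.sum_congr rfl fun l _ => ?_
  simp only [Matrix.mul_smul, Matrix.trace_smul, smul_eq_mul, trPow]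
  ring

/-- The second moments of the power sums are bounded uniformly in the dimension. -/
lemma exists_integral_norm_trPow_sq_le (j : ℕ) :
    ∃ C : ℝ, 0 ≤ C ∧ ∀ (n : ℕ) (μ : Measure (Matrix (Fin n ⊕ Fin n) (Fin n ⊕ Fin n) ℂ)),
      IsHaarSp n μ → ∫ V, ‖trPow (j + 1) V‖ ^ 2 ∂μ ≤ C := by
  induction j using Nat.strong_induction_on with
  | _ j ih =>
  have ih' : ∀ i, ∃ C : ℝ, 0 ≤ C ∧ (i < j → ∀ (n : ℕ) (μ : Measure (Matrix (Fin n ⊕ Fin n)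
      (Fin n ⊕ Fin n) ℂ)), IsHaarSp n μ → ∫ V, ‖trPow (i + 1) V‖ ^ 2 ∂μ ≤ C) := by
    intro i
    by_cases hi : i < j
    · obtain ⟨C, hC0, hC⟩ := ih i hi
      exact ⟨C, hC0, fun _ => hC⟩
    · exact ⟨0, le_rfl, fun h => absurd h hi⟩
  choose C hC0 hC using ih'
  set B : ℝ := 2 * (j + 1) * ∑ m ∈ Finset.range j, (C m + 1) + 1 + 2 * (j + 1) with hB
  have hB0 : 0 ≤ B := by
    have : 0 ≤ ∑ m ∈ Finset.range j, (C m + 1) :=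
      Finset.sum_nonneg fun m _ => by linarith [hC0 m]
    positivity
  refine ⟨2 * B, by positivity, fun n μ hμ => ?_⟩
  have := hμ.1
  have hae : ∀ᵐ U ∂μ, InCompactSp n U := hμ.2.1
  have hint (i : ℕ) : Integrable (fun V => ‖trPow i V‖ ^ 2) μ := by
    have h1 := (integrable_of_continuous hμ ((continuous_trPow (n := n) i).pow 2)).norm
    simpa using h1
  have hloop := integral_trPow_mul hμ j {j + 1} (fun _ => ((j + 1 : ℕ) : ℂ)) id
    (continuous_trPow (j + 1)) (g := fun _ => 1) continuous_const (hasLieGrad_trPow (j + 1))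
  set A := ∫ V, ‖trPow (j + 1) V‖ ^ 2 ∂μ with hA
  have hA0 : 0 ≤ A := integral_nonneg fun V => by positivity
  have hsq : ∫ V, trPow (j + 1) V * trPow (j + 1) V ∂μ = (A : ℂ) := by
    rw [hA, ← integral_complex_ofReal]
    refine integral_congr_ae (hae.mono fun V hV => ?_)
    simp only
    rw [← hV.ofReal_re_trPow]
    simp [sq]
  have b1 : ‖∫ V, (∑ m ∈ Finset.range j, (trPow (m + 1) V * trPow (j - m) V +
      offDiagTrPow (m + 1) (j - m) V)) * trPow (j + 1) V ∂μ‖ ≤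
      2 * n * (2 * (j + 1) * (∑ m ∈ Finset.range j, (C m + 1)) + A / 4) := by
    have hb : ∫ V, 2 * (n : ℝ) * (2 * (j + 1) * (∑ m ∈ Finset.range j, (‖trPow (m + 1) V‖ ^ 2 + 1))
        + ‖trPow (j + 1) V‖ ^ 2 / 4) ∂μ ≤
        2 * n * (2 * (j + 1) * (∑ m ∈ Finset.range j, (C m + 1)) + A / 4) := by
      have hi : ∀ m ∈ Finset.range j, Integrable (fun V => ‖trPow (m + 1) V‖ ^ 2 + 1) μ :=
        fun m _ => (hint _).add (integrable_const 1)
      rw [integral_const_mul, integral_add ((integrable_finsetSum _ hi).const_mul _)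
        ((hint _).div_const _), integral_const_mul, integral_finsetSum _ hi, integral_div]
      gcongr with m hm
      rw [integral_add (hint _) (integrable_const 1)]
      simpa using hC m (Finset.mem_range.1 hm) n μ hμ
    refine le_trans (norm_integral_le_of_norm_le ?_ (hae.mono fun V hV => ?_)) hb
    · exact (((integrable_finsetSum _ fun m _ => (hint _).add (integrable_const 1)).const_mul _).add
        ((hint _).div_const _)).const_mul _
    · rw [norm_mul]
      have hS : ‖∑ m ∈ Finset.range j, (trPow (m + 1) V * trPow (j - m) V +
          offDiagTrPow (m + 1) (j - m) V)‖ ≤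
          ∑ m ∈ Finset.range j, 2 * (n : ℝ) * (‖trPow (m + 1) V‖ + 1) := by
        refine norm_sum_le_of_le _ fun m _ => (norm_add_le _ _).trans ?_
        rw [norm_mul]
        nlinarith [hV.norm_trPow_le (j - m), hV.norm_offDiagTrPow_le (m + 1) (j - m),
          norm_nonneg (trPow (m + 1) V)]
      set x := ‖trPow (j + 1) V‖ with hx
      have hx0 : 0 ≤ x := norm_nonneg _
      refine (mul_le_mul_of_nonneg_right hS hx0).trans ?_
      rw [← Finset.mul_sum, mul_assoc]
      refine mul_le_mul_of_nonneg_left ?_ (by positivity)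
      have hJ : (0 : ℝ) < (j : ℝ) + 1 := by positivity
      calc (∑ m ∈ Finset.range j, (‖trPow (m + 1) V‖ + 1)) * x
          ≤ ∑ m ∈ Finset.range j, (2 * ((j : ℝ) + 1) * (‖trPow (m + 1) V‖ ^ 2 + 1) +
            x ^ 2 / (4 * (j + 1))) := by
            rw [Finset.sum_mul]
            refine Finset.sum_le_sum fun m _ => ?_
            set y := ‖trPow (m + 1) V‖
            have h1 : (y + 1) * x ≤ ((j : ℝ) + 1) * (y + 1) ^ 2 + x ^ 2 / (4 * (j + 1)) := by
              have h2 : ((j : ℝ) + 1) * (y + 1) ^ 2 + x ^ 2 / (4 * (j + 1)) - (y + 1) * x =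
                  (2 * (j + 1) * (y + 1) - x) ^ 2 / (4 * (j + 1)) := by field
              have h3 : 0 ≤ (2 * ((j : ℝ) + 1) * (y + 1) - x) ^ 2 / (4 * (j + 1)) := by positivity
              linarith
            have h4 : (y + 1) ^ 2 ≤ 2 * (y ^ 2 + 1) := by nlinarith [sq_nonneg (y - 1)]
            nlinarith
        _ ≤ 2 * (j + 1) * (∑ m ∈ Finset.range j, (‖trPow (m + 1) V‖ ^ 2 + 1)) + x ^ 2 / 4 := by
            rw [Finset.sum_add_distrib, ← Finset.mul_sum, Finset.sum_const, Finset.card_range,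
              nsmul_eq_mul]
            have : (j : ℝ) * (x ^ 2 / (4 * (j + 1))) ≤ x ^ 2 / 4 := by
              rw [mul_div_assoc', div_le_div_iff₀ (by positivity) (by positivity)]
              nlinarith [sq_nonneg x]
            linarith
  have b2 : ‖∫ V, trPow (j + 1) V ∂μ‖ ≤ 1 + A / 4 := by
    have hb : ∫ V, (1 + ‖trPow (j + 1) V‖ ^ 2 / 4) ∂μ = 1 + A / 4 := by
      rw [integral_add (integrable_const 1) ((hint _).div_const _), integral_div]; simp [hA]
    rw [← hb]
    refine norm_integral_le_of_norm_le ((integrable_const 1).add ((hint _).div_const _))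
      (Filter.Eventually.of_forall fun V => ?_)
    nlinarith [sq_nonneg (‖trPow (j + 1) V‖ - 2)]
  have b3 : ‖∫ V, trPow (j + 1 + (j + 1)) V ∂μ‖ ≤ 2 * n := by
    simpa using norm_integral_le_of_norm_le_const (hae.mono fun V hV => hV.norm_trPow_le _)
  have heta : ‖(eta (j + 1) : ℂ)‖ ≤ 1 := by
    unfold eta; split_ifs <;> simp
  rw [hsq] at hloop
  simp only [Finset.sum_singleton, id, if_true, offDiagTrPow, zero_sub, mul_one] at hloop
  have key : (2 * (n : ℝ) + 1) * A ≤ 2 * n * (B + A / 2) := by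
    have hn := congrArg norm hloop
    have hl : ‖(2 * (n : ℂ) + 1) * (A : ℂ)‖ = (2 * n + 1) * A := by
      rw [show (2 * (n : ℂ) + 1) * (A : ℂ) = (((2 * n + 1) * A : ℝ) : ℂ) by push_cast; ring,
        Complex.norm_of_nonneg (by positivity)]
    rw [hl, integral_neg] at hn
    have t1 : ‖((j + 1 : ℕ) : ℂ) * (-∫ V, trPow (j + 1 + (j + 1)) V ∂μ + 2 * (n : ℂ) *
        ∫ _, (1 : ℂ) ∂μ)‖ ≤ (j + 1) * (2 * n + 2 * n) := by
      rw [norm_mul, Complex.norm_natCast]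
      push_cast
      refine mul_le_mul_of_nonneg_left ((norm_add_le _ _).trans (add_le_add ?_ ?_)) (by positivity)
      · rwa [norm_neg]
      · simp
    have t2 : ‖(eta (j + 1) : ℂ) * (2 * n) * ∫ V, trPow (j + 1) V ∂μ‖ ≤
        1 * (2 * n) * (1 + A / 4) := by
      rw [norm_mul, norm_mul]
      gcongr
      simp
    rw [hn]
    refine (norm_add_le _ _).trans ?_
    refine (add_le_add ((norm_sub_le _ _).trans (add_le_add ((norm_neg _).trans_le b1) t2))
      t1).trans ?_
    rw [hB]
    linarith
  nlinarith

end TracePowers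

section BoundedMean

variable {n : ℕ} {μ : Measure (Matrix (Fin n ⊕ Fin n) (Fin n ⊕ Fin n) ℂ)}

/-- A family of continuous functions, one for each dimension, whose `L¹` norms with respect to
Haar measure are bounded uniformly in the dimension. -/
def HasBoundedMean (F : ∀ n, Matrix (Fin n ⊕ Fin n) (Fin n ⊕ Fin n) ℂ → ℂ) : Prop :=
  (∀ n, Continuous (F n)) ∧ ∃ C : ℝ, ∀ (n : ℕ)
    (μ : Measure (Matrix (Fin n ⊕ Fin n) (Fin n ⊕ Fin n) ℂ)), IsHaarSp n μ →
      ∫ V, ‖F n V‖ ∂μ ≤ C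

namespace HasBoundedMean

variable {F H : ∀ n, Matrix (Fin n ⊕ Fin n) (Fin n ⊕ Fin n) ℂ → ℂ}

lemma of_norm_le (hF : ∀ n, Continuous (F n))
    {f : ∀ n, Matrix (Fin n ⊕ Fin n) (Fin n ⊕ Fin n) ℂ → ℝ} {C : ℝ}
    (hf : ∀ n μ, IsHaarSp n μ → Integrable (f n) μ) (hle : ∀ n V, ‖F n V‖ ≤ f n V)
    (hC : ∀ n μ, IsHaarSp n μ → ∫ V, f n V ∂μ ≤ C) : HasBoundedMean F :=
  ⟨hF, C, fun n μ hμ => (integral_mono (integrable_of_continuous hμ (hF n)).norm (hf n μ hμ)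
    (hle n)).trans (hC n μ hμ)⟩

lemma zero : HasBoundedMean fun _ _ => 0 := ⟨fun _ => continuous_const, 0, by simp⟩

lemma add (hF : HasBoundedMean F) (hH : HasBoundedMean H) :
    HasBoundedMean fun n V => F n V + H n V := by
  obtain ⟨hFc, C, hC⟩ := hF
  obtain ⟨hHc, D, hD⟩ := hH
  refine of_norm_le (f := fun n V => ‖F n V‖ + ‖H n V‖) (C := C + D)
    (fun n => (hFc n).add (hHc n)) (fun n μ hμ => ?_) (fun n V => norm_add_le _ _)
    fun n μ hμ => ?_
  · exact (integrable_of_continuous hμ (hFc n)).norm.add (integrable_of_continuous hμ (hHc n)).norm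
  · rw [integral_add (integrable_of_continuous hμ (hFc n)).norm
      (integrable_of_continuous hμ (hHc n)).norm]
    exact add_le_add (hC n μ hμ) (hD n μ hμ)

lemma neg (hF : HasBoundedMean F) : HasBoundedMean fun n V => -F n V := by
  obtain ⟨hFc, C, hC⟩ := hF
  exact ⟨fun n => (hFc n).neg, C, by simpa using hC⟩

lemma sub (hF : HasBoundedMean F) (hH : HasBoundedMean H) :
    HasBoundedMean fun n V => F n V - H n V := by
  simpa only [sub_eq_add_neg] using hF.add hH.neg

lemma sum {ι : Type*} (s : Finset ι) {F : ι → ∀ n, Matrix (Fin n ⊕ Fin n) (Fin n ⊕ Fin n) ℂ → ℂ}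
    (hF : ∀ i ∈ s, HasBoundedMean (F i)) : HasBoundedMean fun n V => ∑ i ∈ s, F i n V := by
  classical
  induction s using Finset.induction_on with
  | empty => simpa using zero
  | insert a s ha ih =>
    simp only [Finset.sum_insert ha]
    exact (hF a (Finset.mem_insert_self _ _)).add
      (ih fun i hi => hF i (Finset.mem_insert_of_mem hi))

lemma exists_norm_integral_mul_le (hF : HasBoundedMean F) :
    ∃ C : ℝ, ∀ (n : ℕ) (μ : Measure (Matrix (Fin n ⊕ Fin n) (Fin n ⊕ Fin n) ℂ)), IsHaarSp n μ →
      ∀ G : Matrix (Fin n ⊕ Fin n) (Fin n ⊕ Fin n) ℂ → ℂ, (∀ᵐ V ∂μ, ‖G V‖ ≤ 1) →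
        ‖∫ V, F n V * G V ∂μ‖ ≤ C := by
  obtain ⟨hFc, C, hC⟩ := hF
  refine ⟨C, fun n μ hμ G hG => (norm_integral_le_of_norm_le
    (integrable_of_continuous hμ (hFc n)).norm (hG.mono fun V hV => ?_)).trans (hC n μ hμ)⟩
  rw [norm_mul]
  exact mul_le_of_le_one_right (norm_nonneg _) hV

end HasBoundedMean

lemma IsHaarSp.integrable_norm_trPow_sq (hμ : IsHaarSp n μ) (j : ℕ) :
    Integrable (fun V => ‖trPow j V‖ ^ 2) μ := by
  simpa using (integrable_of_continuous hμ ((continuous_trPow (n := n) j).pow 2)).norm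

lemma hasBoundedMean_trPow (j : ℕ) : HasBoundedMean fun _ => trPow (j + 1) := by
  obtain ⟨C, -, hC⟩ := exists_integral_norm_trPow_sq_le j
  refine HasBoundedMean.of_norm_le (f := fun n V => 1 + ‖trPow (j + 1) V‖ ^ 2) (C := 1 + C)
    (fun n => continuous_trPow _) (fun n μ hμ => ?_) (fun n V => ?_) fun n μ hμ => ?_
  · have := hμ.1
    exact (integrable_const 1).add (hμ.integrable_norm_trPow_sq _)
  · nlinarith [sq_nonneg (‖trPow (j + 1) V‖ - 1)]
  · have := hμ.1
    rw [integral_add (integrable_const 1) (hμ.integrable_norm_trPow_sq _)]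
    simpa using hC n μ hμ

lemma hasBoundedMean_offDiagTrPow (a b : ℕ) : HasBoundedMean fun _ => offDiagTrPow a b := by
  unfold offDiagTrPow
  split_ifs with h
  · exact HasBoundedMean.zero
  · obtain ⟨r, hr⟩ : ∃ r, a - b + (b - a) = r + 1 := ⟨a - b + (b - a) - 1, by omega⟩
    simp only [hr]
    exact hasBoundedMean_trPow r

lemma hasBoundedMean_trPow_mul_trPow (i j : ℕ) :
    HasBoundedMean fun _ V => trPow (i + 1) V * trPow (j + 1) V := by
  obtain ⟨C, -, hC⟩ := exists_integral_norm_trPow_sq_le i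
  obtain ⟨D, -, hD⟩ := exists_integral_norm_trPow_sq_le j
  refine HasBoundedMean.of_norm_le (f := fun n V => ‖trPow (i + 1) V‖ ^ 2 + ‖trPow (j + 1) V‖ ^ 2)
    (C := C + D) (fun n => (continuous_trPow _).mul (continuous_trPow _)) (fun n μ hμ => ?_)
    (fun n V => ?_) fun n μ hμ => ?_
  · exact (hμ.integrable_norm_trPow_sq _).add (hμ.integrable_norm_trPow_sq _)
  · rw [norm_mul]
    nlinarith [sq_nonneg (‖trPow (i + 1) V‖ - ‖trPow (j + 1) V‖), sq_nonneg ‖trPow (i + 1) V‖,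
      sq_nonneg ‖trPow (j + 1) V‖]
  · rw [integral_add (hμ.integrable_norm_trPow_sq _) (hμ.integrable_norm_trPow_sq _)]
    exact add_le_add (hC n μ hμ) (hD n μ hμ)

end BoundedMean

section CharacteristicFunction

variable {n k : ℕ} {μ : Measure (Matrix (Fin n ⊕ Fin n) (Fin n ⊕ Fin n) ℂ)}

/-- The linear statistic `i ∑ₗ bₗ Tr (V ^ (l + 1))`. -/
def phase (b : Fin k → ℝ) (V : Matrix (Fin n ⊕ Fin n) (Fin n ⊕ Fin n) ℂ) : ℂ :=
  ∑ l : Fin k, (b l * Complex.I) * trPow ((l : ℕ) + 1) V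

lemma continuous_phase (b : Fin k → ℝ) :
    Continuous (phase b : Matrix (Fin n ⊕ Fin n) (Fin n ⊕ Fin n) ℂ → ℂ) :=
  continuous_finsetSum _ fun _ _ => continuous_const.mul (continuous_trPow _)

lemma InCompactSp.phase_eq {V : Matrix (Fin n ⊕ Fin n) (Fin n ⊕ Fin n) ℂ}
    (hV : InCompactSp n V) (b : Fin k → ℝ) :
    phase b V = ((∑ l : Fin k, b l * (trPow ((l : ℕ) + 1) V).re : ℝ) : ℂ) * Complex.I := by
  unfold phase
  rw [Complex.ofReal_sum, Finset.sum_mul]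
  refine Finset.sum_congr rfl fun l _ => ?_
  rw [Complex.ofReal_mul, hV.ofReal_re_trPow]
  ring

lemma InCompactSp.norm_cexp_mul_phase {V : Matrix (Fin n ⊕ Fin n) (Fin n ⊕ Fin n) ℂ}
    (hV : InCompactSp n V) (b : Fin k → ℝ) (s : ℝ) : ‖Complex.exp (s * phase b V)‖ = 1 := by
  rw [hV.phase_eq, ← mul_assoc, ← Complex.ofReal_mul, Complex.norm_exp_ofReal_mul_I]

lemma hasLieGrad_cexp_mul_phase (b : Fin k → ℝ) (s : ℝ) :
    HasLieGrad (n := n) (fun V => Complex.exp (s * phase b V)) fun V =>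
      ∑ l : Fin k, ((s * b l * Complex.I * ((l : ℕ) + 1 : ℕ)) * Complex.exp (s * phase b V)) •
        V ^ ((l : ℕ) + 1) := by
  have h (V : Matrix (Fin n ⊕ Fin n) (Fin n ⊕ Fin n) ℂ) : (s : ℂ) * phase b V =
      ∑ l : Fin k, (s * b l * Complex.I) * trPow ((l : ℕ) + 1) V := by
    rw [phase, Finset.mul_sum]
    exact Finset.sum_congr rfl fun l _ => by ring
  simp only [h]
  exact hasLieGrad_cexp_sum_trPow Finset.univ _ _

/-- Approximate Gaussian integration by parts, with an error of order `1 / (2n + 1)`. -/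
lemma exists_norm_integral_trPow_mul_cexp_sub_le (b : Fin k → ℝ) (j : Fin k) :
    ∃ C : ℝ, ∀ (n : ℕ) (μ : Measure (Matrix (Fin n ⊕ Fin n) (Fin n ⊕ Fin n) ℂ)), IsHaarSp n μ →
      ∀ s : ℝ, |s| ≤ 1 →
        ‖∫ V, trPow ((j : ℕ) + 1) V * Complex.exp (s * phase b V) ∂μ -
          (((j : ℕ) + 1) * (s * b j) * Complex.I - eta ((j : ℕ) + 1)) *
            ∫ V, Complex.exp (s * phase b V) ∂μ‖ ≤ C / (2 * n + 1) := by
  have hS : HasBoundedMean fun _ V => ∑ m ∈ Finset.range (j : ℕ),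
      (trPow (m + 1) V * trPow (j - m) V + offDiagTrPow (m + 1) (j - m) V) := by
    refine HasBoundedMean.sum _ fun m hm => ?_
    obtain ⟨r, hr⟩ : ∃ r, (j : ℕ) - m = r + 1 :=
      ⟨j - m - 1, by have := Finset.mem_range.1 hm; omega⟩
    rw [hr]
    exact (hasBoundedMean_trPow_mul_trPow _ _).add (hasBoundedMean_offDiagTrPow _ _)
  have hT (l : Fin k) : HasBoundedMean fun _ V => offDiagTrPow ((j : ℕ) + 1) ((l : ℕ) + 1) V -
      trPow ((j : ℕ) + 1 + ((l : ℕ) + 1)) V :=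
    (hasBoundedMean_offDiagTrPow _ _).sub (hasBoundedMean_trPow _)
  obtain ⟨C, hC⟩ := hS.exists_norm_integral_mul_le
  choose D hD using fun l => (hT l).exists_norm_integral_mul_le
  refine ⟨C + ∑ l : Fin k, |b l| * ((l : ℕ) + 1) * D l + (((j : ℕ) + 1) * |b j| + 1),
    fun n μ hμ s hs => ?_⟩
  have := hμ.1
  have hae : ∀ᵐ U ∂μ, InCompactSp n U := hμ.2.1
  have hG : ∀ᵐ V ∂μ, ‖Complex.exp (s * phase b V)‖ ≤ 1 :=
    hae.mono fun V hV => (hV.norm_cexp_mul_phase b s).le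
  have hGc : Continuous fun V : Matrix (Fin n ⊕ Fin n) (Fin n ⊕ Fin n) ℂ =>
      Complex.exp (s * phase b V) := Complex.continuous_exp.comp
        (continuous_const.mul (continuous_phase b))
  have hloop := integral_trPow_mul hμ j Finset.univ _ _ hGc hGc (hasLieGrad_cexp_mul_phase b s)
  have b1 := hC n μ hμ _ hG
  have b2 (l : Fin k) := hD l n μ hμ _ hG
  have b3 : ‖∫ V, Complex.exp (s * phase b V) ∂μ‖ ≤ 1 := by
    simpa using norm_integral_le_of_norm_le_const hG
  set ψ := ∫ V, Complex.exp (s * phase b V) ∂μ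
  set Q := ∫ V, (∑ m ∈ Finset.range (j : ℕ), (trPow (m + 1) V * trPow (j - m) V +
    offDiagTrPow (m + 1) (j - m) V)) * Complex.exp (s * phase b V) ∂μ
  set P := ∫ V, trPow ((j : ℕ) + 1) V * Complex.exp (s * phase b V) ∂μ
  simp_rw [mul_add, Finset.sum_add_distrib, add_left_inj, Fin.val_inj] at hloop
  simp only [ite_mul, mul_ite, zero_mul, mul_zero, Finset.sum_ite_eq, Finset.mem_univ,
    if_true] at hloop
  have hpos : (0 : ℝ) < 2 * n + 1 := by positivity
  rw [le_div_iff₀ hpos, mul_comm]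
  have hnorm : ‖(2 * n + 1 : ℂ)‖ = 2 * n + 1 := by
    rw [show (2 * n + 1 : ℂ) = ((2 * n + 1 : ℝ) : ℂ) by push_cast; rfl,
      Complex.norm_of_nonneg hpos.le]
  rw [← hnorm, ← norm_mul, mul_sub]
  have hrw : (2 * n + 1 : ℂ) * P - (2 * n + 1) *
      ((((j : ℕ) + 1) * (s * b j) * Complex.I - eta ((j : ℕ) + 1)) * ψ) =
      -Q +
      (∑ l : Fin k, s * b l * Complex.I * ((l : ℕ) + 1 : ℕ) *
        ∫ V, (offDiagTrPow ((j : ℕ) + 1) ((l : ℕ) + 1) V - trPow ((j : ℕ) + 1 + ((l : ℕ) + 1)) V) *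
          Complex.exp (s * phase b V) ∂μ) -
      (((j : ℕ) + 1) * (s * b j) * Complex.I - eta ((j : ℕ) + 1)) * ψ := by
    rw [Nat.cast_succ (j : ℕ)] at hloop
    linear_combination hloop
  rw [hrw]
  have heta : ‖(eta ((j : ℕ) + 1) : ℂ)‖ ≤ 1 := by
    unfold eta; split_ifs <;> simp
  refine (norm_sub_le _ _).trans (add_le_add ((norm_add_le _ _).trans (add_le_add
    ((norm_neg _).trans_le b1) (norm_sum_le_of_le _ fun l _ => ?_))) ?_)
  · rw [norm_mul]
    refine mul_le_mul ?_ (b2 l) (norm_nonneg _) (by positivity)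
    rw [norm_mul, norm_mul, norm_mul, Complex.norm_I, Complex.norm_real, Complex.norm_real,
      Complex.norm_natCast, Real.norm_eq_abs, Real.norm_eq_abs, mul_one]
    push_cast
    exact mul_le_mul_of_nonneg_right (mul_le_of_le_one_left (abs_nonneg _) hs) (by positivity)
  · rw [norm_mul]
    refine (mul_le_of_le_one_right (norm_nonneg _) b3).trans ((norm_sub_le _ _).trans
      (add_le_add ?_ heta))
    rw [norm_mul, norm_mul, norm_mul, Complex.norm_I, Complex.norm_real, Complex.norm_real,
      Real.norm_eq_abs, Real.norm_eq_abs, mul_one, ← Nat.cast_succ, Complex.norm_natCast,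
      Nat.cast_succ]
    exact mul_le_mul_of_nonneg_left (mul_le_of_le_one_left (abs_nonneg _) hs) (by positivity)

lemma hasDerivAt_integral_cexp_mul_phase (hμ : IsHaarSp n μ) (b : Fin k → ℝ) (s : ℝ) :
    HasDerivAt (fun s : ℝ => ∫ V, Complex.exp (s * phase b V) ∂μ)
      (∑ l : Fin k, (b l * Complex.I) *
        ∫ V, trPow ((l : ℕ) + 1) V * Complex.exp (s * phase b V) ∂μ) s := by
  have hae : ∀ᵐ U ∂μ, InCompactSp n U := hμ.2.1
  have hc (s : ℝ) : Continuous fun V : Matrix (Fin n ⊕ Fin n) (Fin n ⊕ Fin n) ℂ =>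
      Complex.exp (s * phase b V) := Complex.continuous_exp.comp
        (continuous_const.mul (continuous_phase b))
  have h := (hasDerivAt_integral_of_dominated_loc_of_deriv_le (μ := μ) (x₀ := s)
    (F := fun (s : ℝ) V => Complex.exp (s * phase b V))
    (F' := fun (s : ℝ) V => Complex.exp (s * phase b V) * phase b V)
    (bound := fun V => ‖phase b V‖) (s := Set.univ) Filter.univ_mem
    (Filter.Eventually.of_forall fun s => (integrable_of_continuous hμ (hc s)).1)
    (integrable_of_continuous hμ (hc s))
    (integrable_of_continuous hμ ((hc s).mul (continuous_phase b))).1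
    (hae.mono fun V hV s _ => by
      rw [norm_mul, hV.norm_cexp_mul_phase, one_mul])
    (integrable_of_continuous hμ (continuous_phase b)).norm
    (Filter.Eventually.of_forall fun V s _ => by
      simpa using ((Complex.ofRealCLM.hasDerivAt (x := s)).mul_const (phase b V)).cexp)).2
  refine h.congr_deriv ?_
  have hi (l : Fin k) : Integrable (fun V => (b l * Complex.I) *
      (trPow ((l : ℕ) + 1) V * Complex.exp (s * phase b V))) μ := (integrable_of_continuous hμ
    ((continuous_trPow ((l : ℕ) + 1)).mul (hc s))).const_mul (b l * Complex.I)
  simp_rw [← integral_const_mul]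
  rw [← integral_finsetSum _ fun l _ => hi l]
  refine integral_congr_ae (Filter.Eventually.of_forall fun V => ?_)
  simp only [phase, Finset.mul_sum]
  refine Finset.sum_congr rfl fun l _ => ?_
  ring

theorem tendsto_integral_cexp_phase
    {μ : ∀ n, Measure (Matrix (Fin n ⊕ Fin n) (Fin n ⊕ Fin n) ℂ)}
    (hμ : ∀ n, IsHaarSp n (μ n)) (b : Fin k → ℝ) :
    Tendsto (fun n => ∫ V, Complex.exp (phase b V) ∂(μ n)) atTop
      (𝓝 (Complex.exp (-((∑ l : Fin k, (((l : ℕ) + 1) * b l ^ 2 : ℝ) : ℝ) / 2 +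
        (∑ l : Fin k, b l * eta ((l : ℕ) + 1) : ℝ) * Complex.I)))) := by
  choose C hC using exists_norm_integral_trPow_mul_cexp_sub_le b
  set v : ℝ := ∑ l : Fin k, (((l : ℕ) + 1) * b l ^ 2 : ℝ) with hv
  set m : ℝ := ∑ l : Fin k, b l * eta ((l : ℕ) + 1) with hm
  have hv0 : 0 ≤ v := Finset.sum_nonneg fun l _ => by positivity
  set D : ℝ := ∑ l : Fin k, |b l| * C l with hD
  set E : ℝ → ℂ := fun s => Complex.exp (s ^ 2 * (v / 2) + s * (m * Complex.I)) with hE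
  have hEderiv (s : ℝ) : HasDerivAt E (E s * (s * v + m * Complex.I)) s := by
    have h1 : HasDerivAt (fun s : ℝ => (s : ℂ)) 1 s := Complex.ofRealCLM.hasDerivAt
    refine (((h1.pow 2).mul_const ((v : ℂ) / 2)).add
      (h1.mul_const (m * Complex.I))).cexp.congr_deriv ?_
    simp [hE]
    ring
  have hEnorm (s : ℝ) : ‖E s‖ = Real.exp (s ^ 2 * (v / 2)) := by
    rw [hE, Complex.norm_exp]
    congr 1
    simp [← Complex.ofReal_pow, -Complex.ofReal_ofNat]
  have hbound (n : ℕ) : ‖(∫ V, Complex.exp (phase b V) ∂(μ n)) * E 1 - 1‖ ≤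
      D * Real.exp (v / 2) / (2 * n + 1) := by
    have := (hμ n).1
    have hder (s : ℝ) := (hasDerivAt_integral_cexp_mul_phase (hμ n) b s).mul (hEderiv s)
    refine (le_of_eq ?_).trans (norm_image_sub_le_of_norm_deriv_le_segment_01'
      (fun s _ => (hder s).hasDerivWithinAt) fun s hs => ?_)
    · simp [hE]
    · have hs1 : |s| ≤ 1 := abs_le.2 ⟨by linarith [hs.1], hs.2.le⟩
      set ψ := ∫ V, Complex.exp (s * phase b V) ∂(μ n)
      have herr : (∑ l : Fin k, (b l * Complex.I) *
          ∫ V, trPow ((l : ℕ) + 1) V * Complex.exp (s * phase b V) ∂(μ n)) * E s +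
          ψ * (E s * (s * v + m * Complex.I)) = (∑ l : Fin k, (b l * Complex.I) *
          (∫ V, trPow ((l : ℕ) + 1) V * Complex.exp (s * phase b V) ∂(μ n) -
          (((l : ℕ) + 1) * (s * b l) * Complex.I - eta ((l : ℕ) + 1)) * ψ)) * E s := by
        have h2 : ∑ l : Fin k, (b l * Complex.I) *
            ((((l : ℕ) + 1) * (s * b l) * Complex.I - eta ((l : ℕ) + 1)) * ψ) =
            -((s * v + m * Complex.I) * ψ) := by
          rw [hv, hm]
          push_cast
          rw [Finset.mul_sum, Finset.sum_mul, ← Finset.sum_add_distrib, Finset.sum_mul,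
            ← Finset.sum_neg_distrib]
          refine Finset.sum_congr rfl fun l _ => ?_
          linear_combination (b l ^ 2 * ((l : ℕ) + 1) * s * ψ) * Complex.I_sq
        simp_rw [mul_sub (_ * Complex.I), Finset.sum_sub_distrib, h2]
        ring
      have hDdiv : D / (2 * n + 1) = ∑ l : Fin k, |b l| * (C l / (2 * n + 1)) := by
        rw [hD, Finset.sum_div]
        exact Finset.sum_congr rfl fun l _ => mul_div_assoc _ _ _
      rw [herr, norm_mul, hEnorm, mul_div_right_comm, hDdiv]
      refine mul_le_mul (norm_sum_le_of_le _ fun l _ => ?_) (Real.exp_le_exp.2 ?_)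
        (Real.exp_pos _).le (Finset.sum_nonneg fun l _ => ?_)
      · rw [norm_mul, norm_mul, Complex.norm_I, mul_one, Complex.norm_real, Real.norm_eq_abs]
        exact mul_le_mul_of_nonneg_left (hC l n (μ n) (hμ n) s hs1) (abs_nonneg _)
      · have : s ^ 2 ≤ 1 := (sq_le_one_iff_abs_le_one s).2 hs1
        nlinarith
      · exact mul_nonneg (abs_nonneg _) ((norm_nonneg _).trans (hC l n (μ n) (hμ n) s hs1))
  have hlim : Tendsto (fun n : ℕ => D * Real.exp (v / 2) / (2 * n + 1)) atTop (𝓝 0) := by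
    refine Filter.Tendsto.const_div_atTop ?_ _
    exact Filter.tendsto_atTop_add_const_right _ _
      (tendsto_natCast_atTop_atTop.const_mul_atTop two_pos)
  have h1 : Tendsto (fun n => (∫ V, Complex.exp (phase b V) ∂(μ n)) * E 1) atTop (𝓝 1) :=
    tendsto_iff_norm_sub_tendsto_zero.2 (squeeze_zero (fun _ => norm_nonneg _) hbound hlim)
  have hE1 : E 1 ≠ 0 := Complex.exp_ne_zero _
  have h2 := h1.mul_const (E 1)⁻¹
  simp only [mul_inv_cancel_right₀ hE1, one_mul] at h2
  rw [Complex.exp_neg]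
  simpa [hE] using h2

end CharacteristicFunction

/-- **Diaconis–Shahshahani for Sp(2n).**  If `U_n` is Haar distributed on the compact
symplectic group `Sp(2n)`, then for every fixed `k`, the vector
`(Tr U_n, Tr U_n² / √2, …, Tr U_n^k / √k)` (whose entries are real) converges in
distribution, as `n → ∞`, to `(N₁ − η₁, N₂ − η₂/√2, …, N_k − η_k/√k)`, where the `N_j`
are independent standard real Gaussians; the limit law is the product of the Gaussian
measures on `ℝ` with mean `−η_j/√j` and variance `1`. -/
theorem trace_powers_symplectic_tendsto_gaussian
    (μ : ∀ n, Measure (Matrix (Fin n ⊕ Fin n) (Fin n ⊕ Fin n) ℂ))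
    (hμ : ∀ n, IsHaarSp n (μ n)) (k : ℕ) :
    ∀ g : BoundedContinuousFunction (Fin k → ℝ) ℝ,
      Tendsto
        (fun n => ∫ U, g (fun j : Fin k =>
            (Matrix.trace (U ^ ((j : ℕ) + 1))).re / Real.sqrt ((j : ℕ) + 1)) ∂(μ n))
        atTop
        (𝓝 (∫ x, g x ∂(Measure.pi fun j : Fin k =>
            gaussianReal (-(eta ((j : ℕ) + 1) / Real.sqrt ((j : ℕ) + 1))) 1))) := by
  intro g
  have hpr (n : ℕ) : IsProbabilityMeasure (μ n) := (hμ n).1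
  have hbor (n : ℕ) := borelSpace_matrix_s1 n
  set T : ∀ n, Matrix (Fin n ⊕ Fin n) (Fin n ⊕ Fin n) ℂ → EuclideanSpace ℝ (Fin k) := fun n U =>
    WithLp.toLp 2 fun j : Fin k =>
      (Matrix.trace (U ^ ((j : ℕ) + 1))).re / Real.sqrt ((j : ℕ) + 1) with hT
  have hTc (n : ℕ) : Continuous (T n) := by
    refine (PiLp.continuous_toLp 2 _).comp (continuous_pi fun j => ?_)
    exact (Complex.continuous_re.comp (continuous_trPow _)).div_const _
  have hTm (n : ℕ) : AEMeasurable (T n) (μ n) := (hTc n).measurable.aemeasurable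
  set ν : Measure (Fin k → ℝ) := Measure.pi fun j : Fin k =>
    gaussianReal (-(eta ((j : ℕ) + 1) / Real.sqrt ((j : ℕ) + 1))) 1 with hν
  have hlpm : Measurable (WithLp.toLp 2 : (Fin k → ℝ) → EuclideanSpace ℝ (Fin k)) :=
    (PiLp.continuous_toLp 2 _).measurable
  let P (n : ℕ) : ProbabilityMeasure (EuclideanSpace ℝ (Fin k)) :=
    ⟨(μ n).map (T n), Measure.isProbabilityMeasure_map (hTm n)⟩
  let P₀ : ProbabilityMeasure (EuclideanSpace ℝ (Fin k)) :=
    ⟨ν.map (WithLp.toLp 2), Measure.isProbabilityMeasure_map hlpm.aemeasurable⟩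
  have hP : Tendsto P atTop (𝓝 P₀) := by
    refine ProbabilityMeasure.tendsto_iff_tendsto_charFun.2 fun t => ?_
    have hchar (n : ℕ) :
        charFun ((P n : ProbabilityMeasure _) : Measure (EuclideanSpace ℝ (Fin k))) t =
        ∫ V, Complex.exp (phase (fun l : Fin k => t l / Real.sqrt ((l : ℕ) + 1)) V) ∂(μ n) := by
      change charFun ((μ n).map (T n)) t = _
      rw [charFun_apply, integral_map (hTm n) (by fun_prop)]
      have hae : ∀ᵐ U ∂(μ n), InCompactSp n U := (hμ n).2.1
      refine integral_congr_ae (hae.mono fun V hV => ?_)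
      simp only [hV.phase_eq, PiLp.inner_apply, hT, trPow]
      congr 3
      refine Finset.sum_congr rfl fun l _ => ?_
      simp
      ring
    have hchar₀ : charFun ((P₀ : ProbabilityMeasure _) : Measure (EuclideanSpace ℝ (Fin k))) t =
        Complex.exp (-((∑ l : Fin k, (((l : ℕ) + 1) * (t l / Real.sqrt ((l : ℕ) + 1)) ^ 2 : ℝ) : ℝ)
          / 2 + (∑ l : Fin k, t l / Real.sqrt ((l : ℕ) + 1) * eta ((l : ℕ) + 1) : ℝ) *
            Complex.I)) := by
      change charFun (ν.map (WithLp.toLp 2)) t = _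
      rw [hν, charFun_pi]
      simp_rw [charFun_gaussianReal]
      rw [← Complex.exp_sum]
      congr 1
      rw [Complex.ofReal_sum, Complex.ofReal_sum, Finset.sum_div, Finset.sum_mul,
        ← Finset.sum_add_distrib, ← Finset.sum_neg_distrib]
      refine Finset.sum_congr rfl fun l _ => ?_
      have hl : (((l : ℕ) + 1) * (t l / Real.sqrt ((l : ℕ) + 1)) ^ 2 : ℝ) = t l ^ 2 := by
        rw [div_pow, Real.sq_sqrt (by positivity)]
        field
      rw [hl]
      push_cast
      ring
    simp_rw [hchar]
    rw [hchar₀]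
    exact tendsto_integral_cexp_phase hμ _
  rw [ProbabilityMeasure.tendsto_iff_forall_integral_tendsto] at hP
  have key := hP (g.compContinuous ⟨WithLp.ofLp, PiLp.continuous_ofLp 2 _⟩)
  have h₀ : ∫ x, g (WithLp.ofLp x) ∂(ν.map (WithLp.toLp 2 : _ → EuclideanSpace ℝ (Fin k))) =
      ∫ x, g x ∂ν :=
    integral_map hlpm.aemeasurable
      (g.continuous.comp (PiLp.continuous_ofLp 2 _)).measurable.aestronglyMeasurable
  have h₁ (n : ℕ) : ∫ x, g (WithLp.ofLp x) ∂((μ n).map (T n)) =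
      ∫ U, g (WithLp.ofLp (T n U)) ∂(μ n) :=
    integral_map (hTm n)
      (g.continuous.comp (PiLp.continuous_ofLp 2 _)).measurable.aestronglyMeasurable
  rw [← h₀]
  exact key.congr h₁
end
end
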